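/- arXiv:2508.03308 — 2 statements merged into one kernel-verified Lean document; each statement's English description precedes it below -/
import Mathlib

section
/- Let d be an odd prime and let c_0 ∈ ℂ be a root of the Gleason polynomial G_{d,n} for some n ≥ 1. Set K = ℚ(c_0). Suppose α ∈ K satisfies v_𝔭(α) = 1 for some prime ideal 𝔭 ⊂ O_K lying above d. Then there exists N ≥ 1 such that the Galois group of the splitting field of f_{d,c_0}^N − α over K is non-abelian; equivalently, the arboreal Galois group G_∞(f_{d,c_0}, α) is non-abelian. -/
open Polynomial IntermediateField

noncomputable section

/-- The value sequence `a_i(c)`: `a_0 = 0`, `a_{i+1} = a_i ^ d + c`. -/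
def aSeq (d : ℕ) {F : Type*} [CommRing F] (c : F) : ℕ → F
  | 0 => 0
  | i + 1 => aSeq d c i ^ d + c

/-- The polynomials `a_i ∈ ℤ[c]`: `a_0 = 0`, `a_{i+1} = a_i ^ d + c`. -/
def aPoly (d : ℕ) : ℕ → Polynomial ℤ
  | 0 => 0
  | i + 1 => aPoly d i ^ d + X

/-- Iterates of `f_{d,c} = x^d + c`: `f^0 = x`, `f^{k+1} = f ∘ f^k`. -/
def fIter (d : ℕ) {F : Type*} [CommRing F] (c : F) : ℕ → Polynomial F
  | 0 => X
  | k + 1 => fIter d c k ^ d + C c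

/-- `c₀` is a root of the Gleason polynomial `G_{d,n} = ∏_{k ∣ n} a_k^{μ(n/k)}`. -/
def isGleasonRoot (d n : ℕ) (c₀ : ℂ) : Prop :=
  ∃ g : Polynomial ℤ,
    g * ∏ k ∈ n.divisors, aPoly d k ^ ((-(ArithmeticFunction.moebius (n / k))).toNat)
        = ∏ k ∈ n.divisors, aPoly d k ^ ((ArithmeticFunction.moebius (n / k)).toNat)
    ∧ Polynomial.aeval c₀ g = 0

/-- `c₀` is a root of the Misiurewicz polynomial `G_{d,m,n}^ζ`. -/
def isMisiurewiczRoot (d m n : ℕ) (ζ c₀ : ℂ) : Prop :=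
  ∃ g : Polynomial ℂ,
    g * ((∏ k ∈ n.divisors,
            ((aPoly d (m + k - 1)).map (Int.castRingHom ℂ) -
              C ζ * (aPoly d (m - 1)).map (Int.castRingHom ℂ))
                ^ ((-(ArithmeticFunction.moebius (n / k))).toNat)) *
          (if n ∣ (m - 1) then
            ∏ k ∈ n.divisors, ((aPoly d k).map (Int.castRingHom ℂ))
                ^ ((ArithmeticFunction.moebius (n / k)).toNat)
          else 1))
        = (∏ k ∈ n.divisors,
            ((aPoly d (m + k - 1)).map (Int.castRingHom ℂ) -
              C ζ * (aPoly d (m - 1)).map (Int.castRingHom ℂ))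
                ^ ((ArithmeticFunction.moebius (n / k)).toNat)) *
          (if n ∣ (m - 1) then
            ∏ k ∈ n.divisors, ((aPoly d k).map (Int.castRingHom ℂ))
                ^ ((-(ArithmeticFunction.moebius (n / k))).toNat)
          else 1)
    ∧ g.eval c₀ = 0

/-- The polynomial `F_{k,i}^{(d,c₀)} = ∏_{j=1}^{d-1} (f_{d,c₀}^k - ζ^j a_i(c₀))` over `ℂ`. -/
def FPoly (d : ℕ) (c₀ ζ : ℂ) (k i : ℕ) : Polynomial ℂ :=
  ∏ j ∈ Finset.Icc 1 (d - 1), (fIter d c₀ k - C (ζ ^ j * aSeq d c₀ i))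

lemma map_fIter (d : ℕ) {F E : Type*} [CommRing F] [CommRing E] (φ : F →+* E) (c : F) (k : ℕ) :
    (fIter d c k).map φ = fIter d (φ c) k := by
  induction k with
  | zero => simp [fIter]
  | succ k ih => simp [fIter, ih]

lemma map_aSeq (d : ℕ) {F E : Type*} [CommRing F] [CommRing E] (φ : F →+* E) (c : F) (k : ℕ) :
    φ (aSeq d c k) = aSeq d (φ c) k := by
  induction k with
  | zero => simp [aSeq]
  | succ k ih => simp [aSeq, ih]

lemma aeval_aPoly (d : ℕ) {F : Type*} [CommRing F] (c : F) (k : ℕ) :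
    aeval c (aPoly d k) = aSeq d c k := by
  induction k with
  | zero => simp [aSeq, aPoly]
  | succ k ih => simp [aSeq, aPoly, ih]

lemma eval_zero_fIter {d : ℕ} {F : Type*} [CommRing F] (c : F) (k : ℕ) :
    (fIter d c k).eval 0 = aSeq d c k := by
  induction k with
  | zero => simp [aSeq, fIter]
  | succ k ih => simp [aSeq, fIter, ih]

lemma fIter_of_charP (d : ℕ) [Fact d.Prime] {F : Type*} [CommRing F] [CharP F d] (c : F) (k : ℕ) :
    fIter d c k = X ^ d ^ k + C (aSeq d c k) := by
  induction k with
  | zero => simp [aSeq, fIter]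
  | succ k ih =>
    rw [fIter, ih, add_pow_char, aSeq, C_add, C_pow, pow_succ, pow_mul, add_assoc]

lemma monic_natDegree_fIter {d : ℕ} (hd : 1 ≤ d) {F : Type*} [CommRing F] [Nontrivial F]
    (c : F) (k : ℕ) : (fIter d c k).Monic ∧ (fIter d c k).natDegree = d ^ k := by
  induction k with
  | zero => simp [fIter, monic_X]
  | succ k ih =>
    obtain ⟨hm, hdeg⟩ := ih
    have h1 : (fIter d c k ^ d).natDegree = d ^ (k + 1) := by
      rw [hm.natDegree_pow, hdeg, pow_succ, mul_comm]
    have hpos : 0 < d ^ (k + 1) := by positivity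
    refine ⟨(hm.pow d).add_of_left ?_, ?_⟩
    · refine degree_C_le.trans_lt ?_
      rw [← natDegree_pos_iff_degree_pos, h1]
      exact hpos
    · rw [fIter, natDegree_add_C, h1]

lemma monic_natDegree_aPoly {d : ℕ} (hd : 2 ≤ d) (k : ℕ) :
    (aPoly d (k + 1)).Monic ∧ (aPoly d (k + 1)).natDegree = d ^ k := by
  induction k with
  | zero => simp [aPoly, zero_pow (show d ≠ 0 by omega), monic_X]
  | succ k ih =>
    obtain ⟨hm, hdeg⟩ := ih
    have h1 : (aPoly d (k + 1) ^ d).natDegree = d ^ (k + 1) := by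
      rw [hm.natDegree_pow, hdeg, pow_succ, mul_comm]
    have hlt : (X : ℤ[X]).natDegree < (aPoly d (k + 1) ^ d).natDegree := by
      rw [h1, natDegree_X]
      exact Nat.one_lt_pow (by omega) (by omega)
    rw [aPoly]
    exact ⟨(hm.pow d).add_of_left (degree_lt_degree hlt),
      by rw [natDegree_add_eq_left_of_natDegree_lt hlt, h1]⟩

lemma isIntegral_of_aSeq_eq_zero {d n : ℕ} (hd : 2 ≤ d) (hn : 1 ≤ n) {F : Type*} [CommRing F]
    {c : F} (hc : aSeq d c n = 0) : IsIntegral ℤ c := by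
  obtain ⟨m, rfl⟩ := Nat.exists_eq_succ_of_ne_zero (Nat.one_le_iff_ne_zero.mp hn)
  refine ⟨aPoly d (m + 1), (monic_natDegree_aPoly hd m).1, ?_⟩
  rw [← aeval_def, aeval_aPoly, hc]

lemma aSeq_eq_zero_of_dvd {d : ℕ} {F : Type*} [CommRing F] {c : F} {k n : ℕ}
    (hkn : k ∣ n) (hk : aSeq d c k = 0) : aSeq d c n = 0 := by
  have shift : ∀ j, aSeq d c (k + j) = aSeq d c j := by
    intro j
    induction j with
    | zero => simpa [aSeq] using hk
    | succ j ih => rw [← add_assoc, aSeq, ih, aSeq]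
  obtain ⟨m, rfl⟩ := hkn
  induction m with
  | zero => simp [aSeq]
  | succ m ih => rw [Nat.mul_succ, add_comm, shift, ih]

lemma aSeq_eq_zero_of_isGleasonRoot {d n : ℕ} {c₀ : ℂ} (h : isGleasonRoot d n c₀) :
    aSeq d c₀ n = 0 := by
  obtain ⟨g, hg, h0⟩ := h
  have h1 := congrArg (aeval c₀) hg
  rw [map_mul, h0, zero_mul, map_prod] at h1
  obtain ⟨k, hk, hk0⟩ := Finset.prod_eq_zero_iff.mp h1.symm
  rw [map_pow, aeval_aPoly] at hk0
  exact aSeq_eq_zero_of_dvd (Nat.dvd_of_mem_divisors hk) (eq_zero_of_pow_eq_zero hk0)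

/-- `a_{k+1}' ≡ 1` modulo `d`. -/
lemma exists_derivative_aPoly (d k : ℕ) :
    ∃ q : ℤ[X], derivative (aPoly d (k + 1)) = C (d : ℤ) * q + 1 := by
  refine ⟨aPoly d k ^ (d - 1) * derivative (aPoly d k), ?_⟩
  rw [aPoly, derivative_add, derivative_pow, derivative_X]
  simp [mul_assoc]

lemma eval_fIter_mul {d n : ℕ} (hn : 1 ≤ n) {F : Type*} [CommRing F] (c ζ x : F)
    (hζ : ζ ^ d = 1) : (fIter d c n).eval (x * ζ) = (fIter d c n).eval x := by
  induction n, hn using Nat.le_induction with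
  | base => simp [fIter, mul_pow, hζ]
  | succ k _ ih => simp [fIter, ih]

/-- Eisenstein's criterion applies to `f^n - α` when `0` has period dividing `n`. -/
lemma irreducible_fIter_sub_C {R K : Type*} [CommRing R] [IsDedekindDomain R] [Field K]
    [Algebra R K] [IsFractionRing R K] (v : IsDedekindDomain.HeightOneSpectrum R) {d n : ℕ}
    (hd : d.Prime) (hdv : (d : R) ∈ v.asIdeal) {c : R} (hc : aSeq d c n = 0) {α : K} {a b : R}
    (hb : b ∉ v.asIdeal) (hab : α * algebraMap R K b = algebraMap R K a)
    (ha : a ∈ v.asIdeal) (ha2 : a ∉ v.asIdeal ^ 2) :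
    Irreducible (fIter d (algebraMap R K c) n - C α) := by
  have : Fact d.Prime := ⟨hd⟩
  set w := v.valuation K
  let A := w.valuationSubring
  have hα : w α = w (algebraMap R K a) := by
    rw [← hab, map_mul, (v.valuation_eq_one_iff_notMem).mpr hb, mul_one]
  have hα1 : w α < 1 := by rw [hα]; exact (v.valuation_lt_one_iff_mem a).mpr ha
  have hα2 : ¬ w α ≤ WithZero.exp (-((2 : ℕ) : ℤ)) := by
    rw [hα, IsDedekindDomain.HeightOneSpectrum.valuation_of_algebraMap, v.intValuation_le_pow_iff_mem]
    exact ha2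
  let α' : A := ⟨α, hα1.le⟩
  let c' : A := ⟨algebraMap R K c, v.valuation_le_one c⟩
  let 𝔪 := IsLocalRing.maximalIdeal A
  have hmem : ∀ x : A, x ∈ 𝔪 ↔ w x < 1 := fun x => Valuation.mem_maximalIdeal_iff _ w
  have hsq : ∀ x ∈ 𝔪 ^ 2, w (x : K) ≤ WithZero.exp (-((2 : ℕ) : ℤ)) := by
    intro x hx
    have key : ∀ y : A, y ∈ 𝔪 → w (y : K) ≤ WithZero.exp (-1 : ℤ) := by
      intro y hy
      have := (hmem y).mp hy
      rw [← WithZero.lt_mul_exp_iff_le (by simp), ← WithZero.exp_add]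
      simpa using this
    rw [pow_two] at hx
    refine Submodule.mul_induction_on hx ?_ ?_
    · intro y hy z hz
      have := mul_le_mul' (key y hy) (key z hz)
      rw [← WithZero.exp_add] at this
      simpa using this
    · intro y z hy hz
      exact (w.map_add _ _).trans (max_le hy hz)
  have hc' : aSeq d c' n = 0 := by
    have h := map_aSeq d (algebraMap R K) c n
    rw [hc, map_zero] at h
    have h2 := map_aSeq d (algebraMap A K) c' n
    exact Subtype.ext (h2.trans h.symm)
  obtain ⟨hfm, hfd⟩ := monic_natDegree_fIter hd.one_lt.le c' n
  have hpos : 0 < (fIter d c' n).natDegree := by rw [hfd]; exact pow_pos hd.pos n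
  have hPm : (fIter d c' n - C α').Monic := by
    refine hfm.sub_of_left (degree_C_le.trans_lt ?_)
    rwa [← natDegree_pos_iff_degree_pos]
  have hPd : (fIter d c' n - C α').natDegree = d ^ n := by rw [natDegree_sub_C, hfd]
  have hd𝔪 : (d : A) ∈ 𝔪 := by
    rw [hmem]
    have := (v.valuation_lt_one_iff_mem (K := K) (d : R)).mpr hdv
    simpa using this
  have hchar : CharP (A ⧸ 𝔪) d := by
    have : Nontrivial (A ⧸ 𝔪) := Ideal.Quotient.nontrivial_iff.mpr (IsLocalRing.maximalIdeal.isMaximal A).ne_top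
    refine (CharP.charP_iff_prime_eq_zero hd).mpr ?_
    rw [← map_natCast (Ideal.Quotient.mk 𝔪)]
    exact Ideal.Quotient.eq_zero_iff_mem.mpr hd𝔪
  have hα𝔪 : α' ∈ 𝔪 := (hmem _).mpr hα1
  have hmap : (fIter d c' n - C α').map (Ideal.Quotient.mk 𝔪) = X ^ d ^ n := by
    rw [Polynomial.map_sub, map_fIter, fIter_of_charP, ← map_aSeq, hc', map_C,
      Ideal.Quotient.eq_zero_iff_mem.mpr hα𝔪]
    simp
  have hE : (fIter d c' n - C α').IsEisensteinAt 𝔪 := by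
    refine hPm.isEisensteinAt_of_mem_of_notMem (IsLocalRing.maximalIdeal.isMaximal A).ne_top ?_ ?_
    · intro i hi
      have := congrArg (fun p => p.coeff i) hmap
      simp only [coeff_map, coeff_X_pow] at this
      rw [← Ideal.Quotient.eq_zero_iff_mem, this, if_neg (by omega)]
    · rw [coeff_zero_eq_eval_zero, eval_sub, eval_zero_fIter, hc', eval_C, zero_sub, neg_mem_iff]
      exact fun h => hα2 (hsq _ h)
  have hirr := hE.irreducible (IsLocalRing.maximalIdeal.isMaximal A).isPrime hPm.isPrimitive
    (by rw [hPd]; exact pow_pos hd.pos n)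
  have := (hPm.irreducible_iff_irreducible_map_fraction_map (K := K)).mp hirr
  rw [Polynomial.map_sub, map_fIter, map_C] at this
  exact this

/-- If `d` is prime, then adjoining a primitive `d`-th root of unity makes `d` ramify. -/
lemma natCast_mem_sq_of_isPrimitiveRoot {R : Type*} [CommRing R] [IsDomain R] {P : Ideal R}
    {d : ℕ} (hd : d.Prime) (h3 : 3 ≤ d) (hP : P.IsPrime) (hdP : (d : R) ∈ P) {ζ : R}
    (hζ : IsPrimitiveRoot ζ d) : (d : R) ∈ P ^ 2 := by
  have : Fact d.Prime := ⟨hd⟩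
  have hmem : ∀ μ ∈ primitiveRoots d R, 1 - μ ∈ P := by
    intro μ hμ
    have hμ' := (mem_primitiveRoots hd.pos).mp hμ
    have hchar : CharP (R ⧸ P) d := by
      have : Nontrivial (R ⧸ P) := Ideal.Quotient.nontrivial_iff.mpr hP.ne_top
      refine (CharP.charP_iff_prime_eq_zero hd).mpr ?_
      rw [← map_natCast (Ideal.Quotient.mk P)]
      exact Ideal.Quotient.eq_zero_iff_mem.mpr hdP
    rw [← Ideal.Quotient.eq_zero_iff_mem]
    refine eq_zero_of_pow_eq_zero (n := d) ?_
    rw [map_sub, sub_pow_char, ← map_pow, ← map_pow, hμ'.pow_eq_one, one_pow, sub_self]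
  have h1 : (d : R) = ∏ μ ∈ primitiveRoots d R, (1 - μ) := by
    rw [← eval_one_cyclotomic_prime (R := R) (p := d), cyclotomic_eq_prod_X_sub_primitiveRoots hζ,
      eval_prod]
    simp
  have h2 : ∏ μ ∈ primitiveRoots d R, (1 - μ) ∈ ∏ μ ∈ primitiveRoots d R, P :=
    Ideal.prod_mem_prod hmem
  rw [Finset.prod_const, hζ.card_primitiveRoots, Nat.totient_prime hd, ← h1] at h2
  exact Ideal.pow_le_pow_right (by omega) h2

/-- An abelian extension generated by a root of `f^n - α` of degree `d^n` forces the base field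
to contain the `d`-th roots of unity. -/
lemma exists_isPrimitiveRoot_of_gal_comm {K : Type*} [Field K] [CharZero K] {d n : ℕ}
    (hd : d.Prime) (hn : 1 ≤ n) {c α : K} (hirr : Irreducible (fIter d c n - C α))
    (h0 : (fIter d c n - C α).eval 0 ≠ 0)
    (hcomm : ∀ σ τ : (fIter d c n - C α).Gal, σ * τ = τ * σ) :
    ∃ ζ : K, IsPrimitiveRoot ζ d := by
  set p := fIter d c n - C α with hp
  obtain ⟨hfm, hfd⟩ := monic_natDegree_fIter hd.one_lt.le c n
  have hpd : p.natDegree = d ^ n := by rw [hp, natDegree_sub_C, hfd]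
  have hpm : p.Monic := by
    refine hfm.sub_of_left (degree_C_le.trans_lt ?_)
    rw [← natDegree_pos_iff_degree_pos, hfd]
    exact pow_pos hd.pos n
  let L := p.SplittingField
  let Ω := AlgebraicClosure L
  have : IsGalois K L := IsGalois.of_separable_splitting_field hirr.separable
  have hsplit : (p.map (algebraMap K L)).Splits := SplittingField.splits p
  obtain ⟨β, hβ⟩ := hsplit.exists_eval_eq_zero (by
    rw [degree_map]; exact (degree_pos_of_irreducible hirr).ne')
  have hβp : aeval β p = 0 := by rwa [← eval_map_algebraMap]
  have hβ0 : β ≠ 0 := by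
    rintro rfl
    apply h0
    rw [← map_zero (algebraMap K L), aeval_algebraMap_apply, coe_aeval_eq_eval] at hβp
    exact (algebraMap K L).injective hβp
  have hmin : minpoly K β = p := (minpoly.eq_of_irreducible_of_monic hirr hβp hpm).symm
  have : NeZero (d : Ω) := ⟨Nat.cast_ne_zero.mpr hd.ne_zero⟩
  obtain ⟨ζ', hζ'⟩ := HasEnoughRootsOfUnity.exists_primitiveRoot Ω d
  have hγΩ : ((p.map (algebraMap K L)).map (algebraMap L Ω)).IsRoot (algebraMap L Ω β * ζ') := by
    have h : ∀ x, ((p.map (algebraMap K L)).map (algebraMap L Ω)).eval x =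
        (fIter d (algebraMap L Ω (algebraMap K L c)) n).eval x -
          algebraMap L Ω (algebraMap K L α) := by
      intro x
      simp [hp, map_fIter]
    rw [IsRoot, h, eval_fIter_mul hn _ _ _ hζ'.pow_eq_one, ← h, eval_map_apply, hβ, map_zero]
  obtain ⟨γ, hγ⟩ : algebraMap L Ω β * ζ' ∈ (algebraMap L Ω).range :=
    hsplit.mem_range_of_isRoot (hpm.map _).ne_zero hγΩ
  have hγp : aeval γ p = 0 := by
    rw [IsRoot, ← hγ, eval_map_apply] at hγΩ
    rw [← eval_map_algebraMap]
    exact (algebraMap L Ω).injective (hγΩ.trans (map_zero _).symm)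
  obtain ⟨σ, hσ⟩ : ∃ σ : L ≃ₐ[K] L, σ β = γ :=
    minpoly.exists_algEquiv_of_root' (Algebra.IsAlgebraic.isAlgebraic β) (by rw [hmin, hγp])
  have hγβ : γ ∈ K⟮β⟯ := by
    rw [← IsGalois.fixedField_fixingSubgroup K⟮β⟯]
    rintro ⟨τ, hτ⟩
    have hτβ : τ β = β := hτ ⟨β, mem_adjoin_simple_self K β⟩
    change τ γ = γ
    have h : τ (σ β) = σ (τ β) := DFunLike.congr_fun (hcomm τ σ) β
    rw [← hσ, h, hτβ]
  set ζ : L := γ / β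
  have hζ : IsPrimitiveRoot ζ d := by
    refine IsPrimitiveRoot.of_map_of_injective (f := algebraMap L Ω) ?_ (algebraMap L Ω).injective
    rw [map_div₀, hγ, mul_div_cancel_left₀ _ (by simpa using hβ0)]
    exact hζ'
  have hζβ : ζ ∈ K⟮β⟯ := div_mem hγβ (mem_adjoin_simple_self K β)
  have hdvd : (minpoly K ζ).natDegree ∣ d ^ n := by
    rw [← hpd, ← congrArg natDegree hmin, ← adjoin.finrank (Algebra.IsIntegral.isIntegral ζ),
      ← adjoin.finrank (Algebra.IsIntegral.isIntegral β)]
    exact finrank_dvd_of_le_right (adjoin_simple_le_iff.mpr hζβ)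
  have hle : (minpoly K ζ).natDegree < d := by
    have h1 : minpoly K ζ ∣ cyclotomic d K := by
      refine minpoly.dvd _ _ ?_
      rw [← eval_map_algebraMap, map_cyclotomic]
      exact hζ.isRoot_cyclotomic hd.pos
    have h2 := natDegree_le_of_dvd h1 (cyclotomic_ne_zero d K)
    rw [natDegree_cyclotomic, Nat.totient_prime hd] at h2
    have := hd.pos
    omega
  have hone : (minpoly K ζ).natDegree = 1 := by
    obtain ⟨j, -, hj⟩ := (Nat.dvd_prime_pow hd).mp hdvd
    rcases Nat.eq_zero_or_pos j with rfl | hj0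
    · simpa using hj
    · have := Nat.le_self_pow hj0.ne' d
      omega
  obtain ⟨z, hz⟩ := minpoly.natDegree_eq_one_iff.mp hone
  exact ⟨z, IsPrimitiveRoot.of_map_of_injective (f := algebraMap K L) (by rwa [hz])
    (algebraMap K L).injective⟩

lemma adjoin_gen_eq_top (F : Type*) {E : Type*} [Field F] [Field E] [Algebra F E] (x : E) :
    F⟮AdjoinSimple.gen F x⟯ = ⊤ := by
  apply lift_injective
  rw [lift_adjoin_simple, lift_top, AdjoinSimple.coe_gen]

/-- The prime `d` is unramified in the field generated by a periodic parameter. -/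
lemma natCast_notMem_sq {R K : Type*} [CommRing R] [IsDedekindDomain R] [Field K] [Algebra R K]
    [IsFractionRing R K] [Algebra ℚ K] [FiniteDimensional ℚ K] [IsIntegralClosure R ℤ K]
    {d n : ℕ} (hd : d.Prime) (hn : 1 ≤ n) {c : R} (hc : aSeq d c n = 0)
    (htop : ℚ⟮algebraMap R K c⟯ = ⊤) {P : Ideal R} (hP : P.IsPrime)
    (hdP : (d : R) ∈ P) : (d : R) ∉ P ^ 2 := by
  intro h2
  have : CharZero K := algebraRat.charZero K
  have : CharZero R := ((algebraMap R K).charZero_iff (IsFractionRing.injective R K)).mpr inferInstance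
  have : Algebra.IsIntegral ℤ R := IsIntegralClosure.isIntegral_algebra ℤ K
  have : Module.Finite ℤ R := IsIntegralClosure.finite ℤ ℚ K R
  have hmaxZ : (Ideal.span {(d : ℤ)}).IsMaximal :=
    PrincipalIdealRing.isMaximal_of_irreducible (Nat.prime_iff_prime_int.mp hd).irreducible
  have hdvd : P ^ (2 - 1) ∣ differentIdeal ℤ R := by
    refine pow_sub_one_dvd_differentIdeal ℤ (p := Ideal.span {(d : ℤ)}) P 2 ?_ ?_
    · simpa using hd.ne_zero
    · rw [Ideal.dvd_iff_le, Ideal.map_span, Ideal.span_le]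
      simpa using h2
  have hmem : aeval c (derivative (minpoly ℤ c)) ∈ P := by
    have h := aeval_derivative_mem_differentIdeal ℤ ℚ K (B := R) c ?_
    · have h3 := Ideal.dvd_iff_le.mp hdvd h
      simpa using h3
    · exact Algebra.adjoin_eq_top_of_primitive_element (Algebra.IsAlgebraic.isAlgebraic _) htop
  obtain ⟨m, rfl⟩ := Nat.exists_eq_succ_of_ne_zero (Nat.one_le_iff_ne_zero.mp hn)
  obtain ⟨q, hq⟩ : minpoly ℤ c ∣ aPoly d (m + 1) :=
    minpoly.isIntegrallyClosed_dvd (Algebra.IsIntegral.isIntegral c) (by rw [aeval_aPoly, hc])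
  obtain ⟨r, hr⟩ := exists_derivative_aPoly d m
  have h4 : aeval c (derivative (aPoly d (m + 1))) ∈ P := by
    rw [hq, derivative_mul, map_add, map_mul, map_mul, minpoly.aeval, zero_mul, add_zero]
    exact P.mul_mem_right _ hmem
  rw [hr, map_add, map_mul, map_one] at h4
  have h5 : (1 : R) ∈ P := by
    refine (P.add_mem_iff_right (P.mul_mem_right _ ?_)).mp h4
    simpa using hdP
  exact hP.ne_top ((Ideal.eq_top_iff_one P).mpr h5)

/-- Let `d` be an odd prime, `c₀` a Gleason parameter of period `n ≥ 1`,
`K = ℚ(c₀)`, and `α ∈ K` with `v_𝔭(α) = 1` at some prime `𝔭` of `O_K` above `d`. Then some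
iterated Galois group `Gal(f_{d,c₀}^N - α / K)` is non-abelian (equivalently, the arboreal
Galois group `G_∞(f_{d,c₀}, α)` is non-abelian). -/
theorem stmt6 (d : ℕ) (hd : Nat.Prime d) (hodd : Odd d) (n : ℕ) (hn : 1 ≤ n)
    (c₀ : ℂ) (hc₀ : isGleasonRoot d n c₀)
    (α : ℚ⟮c₀⟯)
    (𝔭 : Ideal (integralClosure ℤ ℚ⟮c₀⟯)) (h𝔭 : 𝔭.IsPrime)
    (h𝔭d : (d : integralClosure ℤ ℚ⟮c₀⟯) ∈ 𝔭)
    (hα : ∃ a b : integralClosure ℤ ℚ⟮c₀⟯, b ∉ 𝔭 ∧ α * b = a ∧ a ∈ 𝔭 ∧ a ∉ 𝔭 ^ 2) :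
    ∃ N : ℕ, 1 ≤ N ∧
      ∃ σ τ : (fIter d (IntermediateField.AdjoinSimple.gen ℚ c₀) N - C α).Gal,
        σ * τ ≠ τ * σ := by
  have hd2 := hd.two_le
  have h3 : 3 ≤ d := by
    obtain ⟨k, rfl⟩ := hodd
    omega
  have ha0 := aSeq_eq_zero_of_isGleasonRoot hc₀
  have hint : IsIntegral ℤ c₀ := isIntegral_of_aSeq_eq_zero hd2 hn ha0
  have hfin : FiniteDimensional ℚ ℚ⟮c₀⟯ := adjoin.finiteDimensional hint.tower_top
  have hg0 : aSeq d (AdjoinSimple.gen ℚ c₀) n = 0 := by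
    apply (algebraMap ℚ⟮c₀⟯ ℂ).injective
    rw [map_aSeq, AdjoinSimple.algebraMap_gen, ha0, map_zero]
  let R := integralClosure ℤ ℚ⟮c₀⟯
  let c : R := ⟨AdjoinSimple.gen ℚ c₀, isIntegral_of_aSeq_eq_zero hd2 hn hg0⟩
  have hc : aSeq d c n = 0 := by
    apply Subtype.ext
    exact (map_aSeq d (algebraMap R ℚ⟮c₀⟯) c n).trans hg0
  have : IsFractionRing R ℚ⟮c₀⟯ := integralClosure.isFractionRing_of_finite_extension ℚ ℚ⟮c₀⟯
  have : IsDedekindDomain R := integralClosure.isDedekindDomain ℤ ℚ ℚ⟮c₀⟯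
  have hdR : (d : R) ≠ 0 := Nat.cast_ne_zero.mpr hd.ne_zero
  let v : IsDedekindDomain.HeightOneSpectrum R :=
    ⟨𝔭, h𝔭, fun h => hdR (by simpa [h] using h𝔭d)⟩
  obtain ⟨a, b, hb, hab, ha, ha2⟩ := hα
  have hirr : Irreducible (fIter d (AdjoinSimple.gen ℚ c₀) n - C α) :=
    irreducible_fIter_sub_C v hd h𝔭d hc hb hab ha ha2
  have hα0 : α ≠ 0 := by
    rintro rfl
    rw [zero_mul] at hab
    have : a = 0 := Subtype.ext hab.symm
    exact ha2 (this ▸ zero_mem _)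
  refine ⟨n, hn, ?_⟩
  by_contra! hcomm
  obtain ⟨z, hz⟩ := exists_isPrimitiveRoot_of_gal_comm hd hn hirr
    (by simpa [eval_zero_fIter, hg0] using hα0) hcomm
  have hzR : IsPrimitiveRoot (⟨z, hz.isIntegral hd.pos⟩ : R) d :=
    IsPrimitiveRoot.of_map_of_injective (f := algebraMap R ℚ⟮c₀⟯) hz
      (IsFractionRing.injective R ℚ⟮c₀⟯)
  let _ : Algebra ℚ ℚ⟮c₀⟯ := ℚ⟮c₀⟯.algebra'
  refine natCast_notMem_sq (K := ℚ⟮c₀⟯) hd hn hc ?_ h𝔭 h𝔭d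
    (natCast_mem_sq_of_isPrimitiveRoot hd h3 h𝔭 h𝔭d hzR)
  exact adjoin_gen_eq_top ℚ c₀
end
end

section
/- Let d be a prime and let ζ ≠ 1 be a d-th root of unity. Let c_0 ∈ ℂ be a root of the Misiurewicz polynomial G_{d,m,n}^ζ for some m ≥ 2, n ≥ 1; if d = 2, assume further that n ≥ 3. Set K = ℚ(c_0), and suppose α ∈ K satisfies v_𝔭(α) ≥ 2 for some prime ideal 𝔭 ⊂ O_K lying above d. Then there exists N ≥ 1 such that the Galois group of the splitting field of f_{d,c_0}^N − α over K is non-abelian; equivalently, the arboreal Galois group G_∞(f_{d,c_0}, α) is non-abelian. -/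
open Polynomial IntermediateField

noncomputable section

section Helpers

open WithZero

lemma fIter_map (d : ℕ) {R S : Type*} [CommRing R] [CommRing S] (φ : R →+* S) (c : R) (k : ℕ) :
    (fIter d c k).map φ = fIter d (φ c) k := by
  induction k with
  | zero => simp [fIter]
  | succ k ih => simp [fIter, ih]

lemma aSeq_map (d : ℕ) {R S : Type*} [CommRing R] [CommRing S] (φ : R →+* S) (c : R) (k : ℕ) :
    φ (aSeq d c k) = aSeq d (φ c) k := by
  induction k with
  | zero => simp [aSeq]
  | succ k ih => simp [aSeq, ih]

lemma aeval_fIter (d : ℕ) {R S : Type*} [CommRing R] [CommRing S] [Algebra R S] (c : R) (k : ℕ)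
    (x : S) : aeval x (fIter d c k) = (fIter d (algebraMap R S c) k).eval x := by
  rw [← fIter_map, eval_map_algebraMap]

lemma eval_fIter_succ (d : ℕ) {R : Type*} [CommRing R] (c : R) (k : ℕ) (x : R) :
    (fIter d c (k + 1)).eval x = (fIter d c k).eval x ^ d + c := by
  simp [fIter]

lemma eval_fIter_succ' (d : ℕ) {R : Type*} [CommRing R] (c : R) (k : ℕ) (x : R) :
    (fIter d c (k + 1)).eval x = (fIter d c k).eval (x ^ d + c) := by
  induction k with
  | zero => simp [fIter]
  | succ k ih => rw [eval_fIter_succ, ih, eval_fIter_succ]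

lemma eval_fIter_aSeq (d : ℕ) {R : Type*} [CommRing R] (c : R) (i j : ℕ) :
    (fIter d c i).eval (aSeq d c j) = aSeq d c (i + j) := by
  induction i with
  | zero => simp [fIter]
  | succ i ih => rw [eval_fIter_succ, ih, Nat.succ_add_eq_add_succ]; rfl

lemma eval_fIter_zero (d : ℕ) {R : Type*} [CommRing R] (c : R) (i : ℕ) :
    (fIter d c i).eval 0 = aSeq d c i :=
  eval_fIter_aSeq d c i 0

lemma fIter_monic_natDegree {d : ℕ} (hd : d ≠ 0) {R : Type*} [CommRing R] [Nontrivial R] (c : R)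
    (k : ℕ) : (fIter d c k).Monic ∧ (fIter d c k).natDegree = d ^ k := by
  induction k with
  | zero => simp [fIter, monic_X]
  | succ k ih =>
    have hm : (fIter d c k ^ d).Monic := ih.1.pow d
    have hdeg : (fIter d c k ^ d).natDegree = d ^ (k + 1) := by
      rw [ih.1.natDegree_pow, ih.2, pow_succ']
    refine ⟨?_, ?_⟩
    · refine hm.add_of_left ?_
      refine lt_of_le_of_lt degree_C_le ?_
      rw [← natDegree_pos_iff_degree_pos, hdeg]; positivity
    · simp only [fIter]
      rw [natDegree_add_C, hdeg]

/-- Modulo `d`, iterating `x ^ d + c` is a Frobenius power followed by a translation. -/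
lemma exists_eval_fIter_eq {d : ℕ} (hd : d.Prime) {R : Type*} [CommRing R] (c x : R) (k : ℕ) :
    ∃ h, (fIter d c k).eval x = x ^ d ^ k + aSeq d c k + d * x * h := by
  induction k with
  | zero => exact ⟨0, by simp [fIter, aSeq]⟩
  | succ k ih =>
    obtain ⟨h, hh⟩ := ih
    obtain ⟨r, hr⟩ := exists_add_pow_prime_eq hd (x ^ d ^ k + d * x * h) (aSeq d c k)
    obtain ⟨s, hs⟩ := exists_add_pow_prime_eq hd (x ^ d ^ k) (d * x * h)
    obtain ⟨q, hq⟩ : x ∣ x ^ d ^ k := dvd_pow_self x (pow_ne_zero _ hd.ne_zero)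
    obtain ⟨q', hq'⟩ : (d * x : R) ∣ (d * x * h) ^ d :=
      (dvd_mul_right _ _).trans (dvd_pow_self _ hd.ne_zero)
    have e : x ^ d ^ k + aSeq d c k + d * x * h = x ^ d ^ k + d * x * h + aSeq d c k := by ring
    refine ⟨q' + x ^ d ^ k * d * h * s + (q + d * h) * aSeq d c k * r, ?_⟩
    rw [eval_fIter_succ, hh, e, hr, hs, hq', aSeq, pow_succ d k, pow_mul]
    linear_combination (d * aSeq d c k * r) * hq

lemma exists_sum_pow_prime_eq {d : ℕ} (hd : d.Prime) {R ι : Type*} [CommRing R] (s : Finset ι)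
    (f : ι → R) : ∃ y, (∑ i ∈ s, f i) ^ d = ∑ i ∈ s, f i ^ d + d * y := by
  classical
  induction s using Finset.induction_on with
  | empty => exact ⟨0, by simp [hd.ne_zero]⟩
  | insert i s hi ih =>
    obtain ⟨y, hy⟩ := ih
    obtain ⟨r, hr⟩ := exists_add_pow_prime_eq hd (f i) (∑ i ∈ s, f i)
    refine ⟨y + f i * (∑ i ∈ s, f i) * r, ?_⟩
    rw [Finset.sum_insert hi, Finset.sum_insert hi, hr, hy]
    ring

/-- A `d`-th root of a Kummer-twisted ratio descends when the Galois group is abelian. -/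
lemma mem_adjoin_of_commute {K E : Type*} [Field K] [Field E] [Algebra K E] [IsGalois K E]
    [FiniteDimensional K E] (hcomm : ∀ σ τ : E ≃ₐ[K] E, σ * τ = τ * σ)
    {d : ℕ} (hd : d.Prime) {ζ : K} (hζ : IsPrimitiveRoot ζ d) {c : K} {β γ : E}
    (hγ : γ ^ d = β - algebraMap K E c) (hγ0 : γ ≠ 0) (σ : E ≃ₐ[K] E) :
    σ γ / γ ∈ K⟮β⟯ := by
  rw [← IsGalois.fixedField_fixingSubgroup K⟮β⟯, IntermediateField.mem_fixedField_iff]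
  intro ρ hρ
  have hρβ : ρ β = β := by
    rw [IntermediateField.mem_fixingSubgroup_iff] at hρ
    exact hρ β (IntermediateField.mem_adjoin_simple_self K β)
  have hd0 : NeZero d := ⟨hd.ne_zero⟩
  have h1 : (ρ γ / γ) ^ d = 1 := by
    have hd' : γ ^ d ≠ 0 := pow_ne_zero _ hγ0
    rw [div_pow, ← map_pow, hγ, map_sub, hρβ, AlgEquiv.commutes, div_self]
    rwa [← hγ]
  obtain ⟨i, -, hi⟩ := (hζ.map_of_injective (algebraMap K E).injective).eq_pow_of_pow_eq_one h1
  have hi' : ρ γ = algebraMap K E (ζ ^ i) * γ := by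
    rw [map_pow, hi, div_mul_cancel₀ _ hγ0]
  have h2 : ρ (σ γ) = σ (ρ γ) := by
    rw [← AlgEquiv.mul_apply, hcomm, AlgEquiv.mul_apply]
  rw [map_div₀, h2, hi', map_mul, AlgEquiv.commutes, mul_div_mul_left]
  rw [map_pow]
  exact pow_ne_zero _ ((_root_.map_ne_zero _).2 (hζ.ne_zero hd.ne_zero))

section Ramified

variable {K E : Type*} [Field K] [Field E] [Algebra K E] {v : Valuation K ℤᵐ⁰}
  {w : Valuation E ℤᵐ⁰} {e : ℕ} {D : ℕ} {b : ℤ} {β : E}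

lemma exists_exp_eq {x : ℤᵐ⁰} (hx : x ≠ 0) : ∃ j : ℤ, x = exp j :=
  ⟨log x, (exp_log hx).symm⟩

lemma val_coeff_mul_pow (hw : ∀ k, w (algebraMap K E k) = v k ^ e) (hβ : w β = exp (-b))
    (hD : (D : ℤ) * b = e) {k : K} (hk : k ≠ 0) (i : ℕ) :
    ∃ j : ℤ, w (algebraMap K E k * β ^ i) = exp (b * (D * j - i)) := by
  obtain ⟨j, hj⟩ := exists_exp_eq (v.ne_zero_iff.2 hk)
  refine ⟨j, ?_⟩
  rw [map_mul, map_pow, hw, hj, hβ, ← exp_nsmul, ← exp_nsmul, ← exp_add]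
  congr 1
  simp only [nsmul_eq_mul, ← hD]
  ring

lemma val_coeff_mul_pow_injOn (hw : ∀ k, w (algebraMap K E k) = v k ^ e) (hβ : w β = exp (-b))
    (hb : 0 < b) (hD : (D : ℤ) * b = e) {p : K[X]} (hp : p.natDegree < D) :
    Set.InjOn (fun i => w (algebraMap K E (p.coeff i) * β ^ i)) p.support := by
  intro i hi i' hi' h
  rw [Finset.mem_coe, mem_support_iff] at hi hi'
  obtain ⟨j, hj⟩ := val_coeff_mul_pow hw hβ hD hi i
  obtain ⟨j', hj'⟩ := val_coeff_mul_pow hw hβ hD hi' i'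
  simp only [hj, hj', exp_inj] at h
  have h1 := mul_left_cancel₀ hb.ne' h
  have h2 : i < D := (le_natDegree_of_ne_zero hi).trans_lt hp
  have h3 : i' < D := (le_natDegree_of_ne_zero hi').trans_lt hp
  have h4 : (D : ℤ) * (j - j') = i - i' := by linear_combination h1
  have h5 : (D : ℤ) ∣ i - i' := ⟨_, h4.symm⟩
  have h6 := Int.eq_zero_of_abs_lt_dvd h5 (by rw [abs_lt]; omega)
  omega

/-- In a totally ramified setting the valuation of a polynomial in the uniformizer is attained at a
single term. -/
lemma exists_val_aeval_eq (hw : ∀ k, w (algebraMap K E k) = v k ^ e) (hβ : w β = exp (-b))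
    (hb : 0 < b) (hD : (D : ℤ) * b = e) {p : K[X]} (hp : p.natDegree < D) (hp0 : p ≠ 0) :
    ∃ i ∈ p.support, w (aeval β p) = w (algebraMap K E (p.coeff i) * β ^ i) ∧
      ∀ j, w (algebraMap K E (p.coeff j) * β ^ j) ≤ w (algebraMap K E (p.coeff i) * β ^ i) := by
  classical
  obtain ⟨i, hi, hmax⟩ := Finset.exists_max_image p.support
    (fun i => w (algebraMap K E (p.coeff i) * β ^ i)) (support_nonempty.2 hp0)
  refine ⟨i, hi, ?_, fun j => ?_⟩
  · rw [aeval_eq_sum_range, ← p.sum_over_range' (f := fun i a => a • β ^ i) (by simp) _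
      (Nat.lt_succ_self _), sum_def]
    simp only [Algebra.smul_def]
    rw [Valuation.map_sum_eq_of_lt (j := i) w hi]
    intro j hj
    rw [Finset.mem_sdiff, Finset.mem_singleton] at hj
    refine lt_of_le_of_ne (hmax j hj.1) fun h => hj.2 ?_
    exact val_coeff_mul_pow_injOn hw hβ hb hD hp hj.1 hi h
  · by_cases hj : j ∈ p.support
    · exact hmax j hj
    · rw [notMem_support_iff.1 hj]; simp

lemma val_aeval_mem (hw : ∀ k, w (algebraMap K E k) = v k ^ e) (hβ : w β = exp (-b))
    (hb : 0 < b) (hD : (D : ℤ) * b = e) {p : K[X]} (hp : p.natDegree < D) (hp0 : p ≠ 0) :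
    ∃ s : ℤ, w (aeval β p) = exp (-(b * s)) := by
  obtain ⟨i, hi, h, -⟩ := exists_val_aeval_eq hw hβ hb hD hp hp0
  obtain ⟨j, hj⟩ := val_coeff_mul_pow hw hβ hD (mem_support_iff.1 hi) i
  exact ⟨-(D * j - i), by rw [h, hj]; congr 1; ring⟩

lemma minpoly_eq_of_ramified (hw : ∀ k, w (algebraMap K E k) = v k ^ e) (hβ : w β = exp (-b))
    (hb : 0 < b) (hD : (D : ℤ) * b = e) {p : K[X]} (hp : p.Monic) (hdeg : p.natDegree = D)
    (h0 : aeval β p = 0) : minpoly K β = p := by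
  have h_int : IsIntegral K β := ⟨p, hp, h0⟩
  have hle : p.natDegree ≤ (minpoly K β).natDegree := by
    by_contra! hlt
    obtain ⟨s, hs⟩ := val_aeval_mem hw hβ hb hD (hdeg ▸ hlt) (minpoly.ne_zero h_int)
    rw [minpoly.aeval, map_zero] at hs
    exact exp_ne_zero hs.symm
  exact (eq_of_monic_of_dvd_of_natDegree_le (minpoly.monic h_int) hp (minpoly.dvd K β h0) hle).symm

lemma exists_aeval_eq_of_mem_adjoin (h_int : IsIntegral K β) {x : E} (hx : x ∈ K⟮β⟯) :
    ∃ q : K[X], q.natDegree < (minpoly K β).natDegree ∧ aeval β q = x := by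
  rw [← IntermediateField.mem_toSubalgebra,
    IntermediateField.adjoin_simple_toSubalgebra_of_isAlgebraic h_int.isAlgebraic,
    Algebra.adjoin_singleton_eq_range_aeval] at hx
  obtain ⟨q, rfl⟩ := hx
  refine ⟨q %ₘ minpoly K β, ?_, ?_⟩
  · exact natDegree_modByMonic_lt _ (minpoly.monic h_int) (minpoly.ne_one K β)
  · simp [aeval_modByMonic_eq_self_of_root (minpoly.aeval K β)]


lemma exists_one_add_pow_prime {d : ℕ} (hd : d.Prime) {t : E} (ht : w t ≤ 1) :
    ∃ r, w r ≤ 1 ∧ (1 + t) ^ d = 1 + t ^ d + d * t * r := by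
  obtain ⟨r, hr⟩ := exists_add_pow_prime_eq hd (1 : w.integer) ⟨t, ht⟩
  refine ⟨r, r.2, ?_⟩
  simpa using congrArg (w.integer.subtype) hr

lemma one_lt_val_eval_fIter {d : ℕ} (hd : d ≠ 0) {c x : E} (hc : w c ≤ 1) (hx : 1 < w x) (k : ℕ) :
    1 < w ((fIter d c k).eval x) := by
  induction k with
  | zero => simpa [fIter]
  | succ k ih =>
    have h1 : 1 < w ((fIter d c k).eval x ^ d) := by
      rw [map_pow]; exact one_lt_pow' ih hd
    rwa [eval_fIter_succ, w.map_add_eq_of_lt_left (hc.trans_lt h1)]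

lemma val_pow_eq_of_eval_fIter {d : ℕ} (hd : d.Prime) {n : ℕ} {c α : K}
    (hw : ∀ k, w (algebraMap K E k) = v k ^ e) (he : e ≠ 0)
    (hvd : v d < 1) (hc : v c ≤ 1) (ha : v (aSeq d c n) = exp (-1)) (hα : v α ≤ exp (-2))
    (hβ : (fIter d (algebraMap K E c) n).eval β = algebraMap K E α) :
    w β ^ d ^ n = exp (-(e : ℤ)) := by
  have hD : d ^ n ≠ 0 := pow_ne_zero _ hd.ne_zero
  have hwc : w (algebraMap K E c) ≤ 1 := by rw [hw]; exact pow_le_one' hc e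
  have hα1 : v α < exp (-1) := hα.trans_lt (by rw [exp_lt_exp]; norm_num)
  have hβ1 : w β ≤ 1 := by
    by_contra! h
    have := one_lt_val_eval_fIter hd.ne_zero hwc h n
    rw [hβ, hw] at this
    refine absurd (pow_le_one' (n := e) ?_) this.not_ge
    exact hα1.le.trans (by rw [← exp_zero, exp_le_exp]; norm_num)
  obtain ⟨h, hh⟩ := exists_eval_fIter_eq hd (⟨_, hwc⟩ : w.integer) ⟨β, hβ1⟩ n
  have hh' := congrArg (w.integer.subtype) hh
  rw [← eval_map_apply, fIter_map, map_add, map_add, aSeq_map] at hh'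
  simp only [Subring.subtype_apply, map_mul, map_pow, map_natCast] at hh'
  rw [hβ, ← aSeq_map] at hh'
  have hA : w (algebraMap K E (α - aSeq d c n)) = exp (-(e : ℤ)) := by
    rw [hw, v.map_sub_eq_of_lt_right (by rwa [ha]), ha, ← exp_nsmul]; simp
  have hwd : w (d : E) ≤ exp (-(e : ℤ)) := by
    have : v (d : K) ≤ exp (-1) := by
      rwa [← lt_mul_exp_iff_le (by simp), ← exp_add, neg_add_cancel, exp_zero]
    have h2 := pow_le_pow_left' this e
    rw [← hw, map_natCast, ← exp_nsmul] at h2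
    simpa using h2
  have hle : w ((d : E) * β * h) ≤ exp (-(e : ℤ)) * w β := by
    rw [map_mul, map_mul]
    exact mul_le_of_le_one_right' (a := w (d : E) * w β) h.2 |>.trans (mul_le_mul_left hwd _)
  have heq : β ^ d ^ n = algebraMap K E (α - aSeq d c n) - d * β * h := by
    rw [map_sub]; linear_combination -hh'
  have hexp : exp (-(e : ℤ)) < 1 := by rw [← exp_zero, exp_lt_exp]; omega
  have hβ2 : w β < 1 := by
    have : w (β ^ d ^ n) < 1 := by
      rw [heq]
      refine w.map_sub_lt (hA ▸ hexp) (hle.trans_lt ?_)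
      exact (mul_le_of_le_one_right' hβ1).trans_lt hexp
    rw [map_pow] at this
    exact (pow_lt_one_iff hD).1 this
  rw [← map_pow, heq, w.map_sub_eq_of_lt_left, hA]
  rw [hA]
  refine hle.trans_lt ?_
  exact mul_lt_of_lt_one_right (by simp) hβ2

lemma exists_val_eq_exp {D : ℕ} (hD : D ≠ 0) (he : e ≠ 0) (h : w β ^ D = exp (-(e : ℤ))) :
    ∃ b : ℤ, 0 < b ∧ w β = exp (-b) ∧ (D : ℤ) * b = e := by
  have h0 : w β ≠ 0 := fun h0 => by
    rw [h0, zero_pow hD] at h; exact exp_ne_zero h.symm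
  obtain ⟨j, hj⟩ := exists_exp_eq h0
  rw [hj, ← exp_nsmul, exp_inj, nsmul_eq_mul] at h
  refine ⟨-j, ?_, by rw [hj, neg_neg], by linarith⟩
  by_contra! hb
  have : 0 ≤ (D : ℤ) * j := mul_nonneg (by positivity) (by linarith)
  omega

/-- The `d`-th power obstruction when `c` is a unit. -/
lemma not_pow_of_unit {d n : ℕ} (hd : d.Prime) (hn : n ≠ 0) {ζ c : K} {V : ℤ} (hV : 1 ≤ V)
    (hw : ∀ k, w (algebraMap K E k) = v k ^ e)
    (hβ : w β = exp (-b)) (hb : 0 < b) (hD : ((d ^ n : ℕ) : ℤ) * b = e)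
    (hmin : (minpoly K β).natDegree = d ^ n) (h_int : IsIntegral K β)
    (hζ : v (ζ - 1) = exp (-V)) (hdζ : v d ≤ v (ζ - 1)) (hc : v c = 1)
    {x : E} (hx : x ∈ K⟮β⟯)
    (hxd : x ^ d = (algebraMap K E ζ * β - algebraMap K E c) / (β - algebraMap K E c)) :
    False := by
  have hwc : w (algebraMap K E c) = 1 := by rw [hw, hc, one_pow]
  have hβ1 : w β < 1 := by rw [hβ, ← exp_zero, exp_lt_exp]; omega
  have hβc : w (β - algebraMap K E c) = 1 := by
    rw [w.map_sub_eq_of_lt_right (by rwa [hwc]), hwc]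
  have hβc0 : β - algebraMap K E c ≠ 0 := by
    rw [← w.ne_zero_iff, hβc]; exact one_ne_zero
  have hwζ : w (algebraMap K E (ζ - 1)) = exp (-((d ^ n : ℕ) * b * V)) := by
    rw [hw, hζ, ← exp_nsmul, hD]; simp
  have hu : x ^ d - 1 = algebraMap K E (ζ - 1) * β / (β - algebraMap K E c) := by
    rw [hxd, map_sub, map_one]; field_simp; ring
  have hwu : w (x ^ d - 1) = exp (-((d ^ n : ℕ) * b * V + b)) := by
    rw [hu, map_div₀, hβc, div_one, map_mul, hwζ, hβ, ← exp_add]; congr 1; ring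
  have hDpos : (0 : ℤ) < (d ^ n : ℕ) := by exact_mod_cast pow_pos hd.pos n
  have hu1 : w (x ^ d - 1) < 1 := by
    rw [hwu, ← exp_zero, exp_lt_exp]
    have : 0 ≤ (d ^ n : ℕ) * b * V := by positivity
    omega
  have hx1 : w x = 1 := by
    have : w (x ^ d) = 1 := by
      have := w.map_one_add_of_lt hu1
      rwa [add_sub_cancel] at this
    rw [map_pow] at this
    exact (pow_eq_one_iff.1 this).resolve_right hd.ne_zero
  obtain ⟨t, rfl⟩ : ∃ t, x = 1 + t := ⟨x - 1, by ring⟩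
  have ht1 : w t ≤ 1 := by
    have : t = (1 + t) - 1 := by ring
    rw [this]; exact w.map_sub_le hx1.le w.map_one.le
  have ht0 : t ≠ 0 := by
    rintro rfl
    rw [add_zero, one_pow, sub_self, map_zero] at hwu
    exact exp_ne_zero hwu.symm
  obtain ⟨r, hr, hpow⟩ := exists_one_add_pow_prime hd ht1
  have htmem : t ∈ K⟮β⟯ := by simpa using sub_mem hx (one_mem K⟮β⟯)
  obtain ⟨q, hq, rfl⟩ := exists_aeval_eq_of_mem_adjoin h_int htmem
  rw [hmin] at hq
  obtain ⟨s, hs⟩ := val_aeval_mem hw hβ hb hD hq (by rintro rfl; simp at ht0)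
  set t := aeval β q
  have heq : t ^ d = ((1 + t) ^ d - 1) - d * t * r := by rw [hpow]; ring
  have hwd : w (d : E) ≤ exp (-((d ^ n : ℕ) * b * V)) := by
    rw [← hwζ, hw, ← map_natCast (algebraMap K E), hw]
    exact pow_le_pow_left' hdζ e
  have herr : w (d * t * r) ≤ exp (-((d ^ n : ℕ) * b * V + b * s)) := by
    rw [map_mul, map_mul]
    refine (mul_le_of_le_one_right' hr).trans ?_
    rw [hs, neg_add, exp_add]
    exact mul_le_mul_left hwd _
  have hs0 : 0 ≤ s := by
    rw [hs, ← exp_zero, exp_le_exp] at ht1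
    nlinarith
  have hbV : (d ^ n : ℕ) * b ≤ (d ^ n : ℕ) * b * V := by
    nlinarith [mul_pos hDpos hb]
  have hdD : (d : ℤ) ≤ (d ^ n : ℕ) := by
    exact_mod_cast Nat.le_self_pow hn d
  have hd2 : (2 : ℤ) ≤ d := by exact_mod_cast hd.two_le
  have htd : w (t ^ d) = exp (-(d * (b * s))) := by
    rw [map_pow, hs, ← exp_nsmul]; simp
  have hs1 : s ≠ 0 := by
    rintro rfl
    have : w (t ^ d) < 1 := by
      rw [heq]
      refine w.map_sub_lt hu1 (herr.trans_lt ?_)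
      rw [← exp_zero, exp_lt_exp]
      nlinarith [mul_pos hDpos hb]
    rw [htd] at this
    simp at this
  rcases (by omega : s = 1 ∨ 2 ≤ s) with rfl | hs2
  · have : w (t ^ d) ≤ exp (-((d ^ n : ℕ) * b * V + b)) := by
      rw [heq]
      exact w.map_sub_le hwu.le (by simpa using herr)
    rw [htd, exp_le_exp] at this
    nlinarith
  · have : w (t ^ d) = exp (-((d ^ n : ℕ) * b * V + b)) := by
      rw [heq, w.map_sub_eq_of_lt_left, hwu]
      rw [hwu]
      refine herr.trans_lt ?_
      rw [exp_lt_exp]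
      nlinarith
    rw [htd, exp_inj] at this
    have h3 : (d : ℤ) * s = (d ^ n : ℕ) * V + 1 := by
      apply mul_left_cancel₀ hb.ne'
      linear_combination -this
    have h4 : (d : ℤ) ∣ (d ^ n : ℕ) * V := by
      push_cast
      exact Dvd.dvd.mul_right (dvd_pow_self _ hn) _
    have h5 : (d : ℤ) ∣ 1 := by
      rw [show (1 : ℤ) = d * s - (d ^ n : ℕ) * V by linear_combination -h3]
      exact dvd_sub (dvd_mul_right _ _) h4
    have := Int.le_of_dvd one_pos h5
    omega

/-- The `d`-th power obstruction in the period one case. -/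
lemma not_pow_of_uniformizer {d : ℕ} (hd : d.Prime) (hd3 : 3 ≤ d) {ζ c κ : K} {V : ℤ} (hV : 1 ≤ V)
    (hw : ∀ k, w (algebraMap K E k) = v k ^ e)
    (hβ : w β = exp (-b)) (hb : 0 < b) (hD : (d : ℤ) * b = e)
    (hβd : β ^ d = algebraMap K E κ) (hvζ1 : v ζ ≤ 1)
    (hmin : (minpoly K β).natDegree = d) (h_int : IsIntegral K β)
    (hζ : v (ζ - 1) = exp (-V)) (hdζ : v d ≤ v (ζ - 1) ^ 2) (hc : v c = exp (-1))
    {x : E} (hx : x ∈ K⟮β⟯)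
    (hxd : x ^ d = (algebraMap K E ζ * β - algebraMap K E c) / (β - algebraMap K E c)) :
    False := by
  have hd3' : (3 : ℤ) ≤ d := by exact_mod_cast hd3
  have hwc : w (algebraMap K E c) = exp (-(d * b)) := by rw [hw, hc, ← exp_nsmul, hD]; simp
  have hβc : w (β - algebraMap K E c) = exp (-b) := by
    rw [w.map_sub_eq_of_lt_left, hβ]
    rw [hwc, hβ, exp_lt_exp]
    nlinarith
  have hβc0 : β - algebraMap K E c ≠ 0 := by
    rw [← w.ne_zero_iff, hβc]; exact exp_ne_zero
  have hwζ : w (algebraMap K E (ζ - 1)) = exp (-(d * b * V)) := by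
    rw [hw, hζ, ← exp_nsmul, hD]; simp
  have hu : x ^ d - algebraMap K E ζ =
      algebraMap K E (ζ - 1) * algebraMap K E c / (β - algebraMap K E c) := by
    rw [hxd, map_sub, map_one]; field_simp; ring
  have hwu : w (x ^ d - algebraMap K E ζ) = exp (-(d * b * V + (d - 1) * b)) := by
    rw [hu, map_div₀, hβc, map_mul, hwζ, hwc, ← exp_add, ← exp_sub]; congr 1; ring
  have hwζ1 : w (algebraMap K E ζ) ≤ 1 := by rw [hw]; exact pow_le_one' hvζ1 e
  have hbV : d * b ≤ d * b * V := by nlinarith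
  have hx1 : w x ≤ 1 := by
    have h1 : w (x ^ d) ≤ 1 := by
      have : x ^ d = (x ^ d - algebraMap K E ζ) + algebraMap K E ζ := by ring
      rw [this]
      refine w.map_add_le ?_ hwζ1
      rw [hwu, ← exp_zero, exp_le_exp]
      nlinarith
    rw [map_pow] at h1
    exact (pow_le_one_iff hd.ne_zero).1 h1
  obtain ⟨q, hq, rfl⟩ := exists_aeval_eq_of_mem_adjoin h_int hx
  rw [hmin] at hq
  have hterm : ∀ i, w (algebraMap K E (q.coeff i) * β ^ i) ≤ 1 := by
    intro i
    by_cases hq0 : q = 0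
    · simp [hq0]
    · obtain ⟨j, -, hj, hmax⟩ := exists_val_aeval_eq hw hβ hb hD hq hq0
      exact (hmax i).trans (hj ▸ hx1)
  obtain ⟨y, hy⟩ := exists_sum_pow_prime_eq hd (Finset.range (q.natDegree + 1))
    (fun i => (⟨_, hterm i⟩ : w.integer))
  have hy' := congrArg (w.integer.subtype) hy
  simp only [map_pow, map_sum, map_add, map_mul, map_natCast, Subring.subtype_apply] at hy'
  have hexp : aeval β q = ∑ i ∈ Finset.range (q.natDegree + 1),
      algebraMap K E (q.coeff i) * β ^ i := by
    rw [aeval_eq_sum_range]; simp only [Algebra.smul_def]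
  rw [← hexp] at hy'
  set κ' : K := ∑ i ∈ Finset.range (q.natDegree + 1), q.coeff i ^ d * κ ^ i
  have hκ' : ∑ i ∈ Finset.range (q.natDegree + 1), (algebraMap K E (q.coeff i) * β ^ i) ^ d =
      algebraMap K E κ' := by
    rw [map_sum]
    refine Finset.sum_congr rfl fun i _ => ?_
    rw [mul_pow, pow_right_comm, hβd]; simp
  rw [hκ'] at hy'
  have hwd : w (d * (y : E)) ≤ exp (-(d * b * V + d * b * V)) := by
    rw [map_mul]
    refine (mul_le_of_le_one_right' y.2).trans ?_
    rw [neg_add, exp_add, ← hwζ, hw, ← map_natCast (algebraMap K E), hw, ← mul_pow, ← pow_two]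
    exact pow_le_pow_left' hdζ e
  have hfin : w (algebraMap K E (κ' - ζ)) = exp (-(d * b * V + (d - 1) * b)) := by
    have : algebraMap K E (κ' - ζ) = (aeval β q ^ d - algebraMap K E ζ) - d * y := by
      rw [hy', map_sub]; ring
    rw [this, w.map_sub_eq_of_lt_left, hwu]
    rw [hwu]
    refine hwd.trans_lt ?_
    rw [exp_lt_exp]
    nlinarith
  have h0 : κ' - ζ ≠ 0 := by
    intro h0
    rw [h0, map_zero, map_zero] at hfin
    exact exp_ne_zero hfin.symm
  obtain ⟨j, hj⟩ := exists_exp_eq (v.ne_zero_iff.2 h0)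
  rw [hw, hj, ← exp_nsmul, exp_inj, nsmul_eq_mul, ← hD] at hfin
  have h3 : (d : ℤ) * (j + V + 1) = 1 := by
    apply mul_left_cancel₀ hb.ne'
    linear_combination hfin
  have := Int.le_of_dvd one_pos ⟨_, h3.symm⟩
  omega

end Ramified
/-- An adic valuation extends to a finite separable extension, up to a ramification exponent. -/
lemma exists_valuation_extension {A K E : Type*} [CommRing A] [IsDedekindDomain A] [Field K]
    [Algebra A K] [IsFractionRing A K] [Field E] [Algebra K E] [FiniteDimensional K E]
    [Algebra.IsSeparable K E] (𝔭 : IsDedekindDomain.HeightOneSpectrum A) :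
    ∃ (w : Valuation E ℤᵐ⁰) (e : ℕ), e ≠ 0 ∧
      ∀ k, w (algebraMap K E k) = 𝔭.valuation K k ^ e := by
  let : Algebra A E := ((algebraMap K E).comp (algebraMap A K)).toAlgebra
  have : IsScalarTower A K E := IsScalarTower.of_algebraMap_eq fun _ => rfl
  have : IsDedekindDomain (integralClosure A E) := integralClosure.isDedekindDomain A K E
  have : IsFractionRing (integralClosure A E) E :=
    integralClosure.isFractionRing_of_finite_extension K E
  have : FaithfulSMul A E := by
    rw [faithfulSMul_iff_algebraMap_injective]
    exact (algebraMap K E).injective.comp (IsFractionRing.injective A K)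
  have : Module.IsTorsionFree A (integralClosure A E) := inferInstance
  have := 𝔭.isMaximal
  obtain ⟨Q, hQ, hQ'⟩ := Ideal.exists_maximal_ideal_liesOver_of_isIntegral
    (S := integralClosure A E) 𝔭.asIdeal
  let W : IsDedekindDomain.HeightOneSpectrum (integralClosure A E) :=
    ⟨Q, hQ.isPrime, Ideal.ne_bot_of_liesOver_of_ne_bot 𝔭.ne_bot Q⟩
  have : W.asIdeal.LiesOver 𝔭.asIdeal := hQ'
  refine ⟨W.valuation E, 𝔭.asIdeal.ramificationIdx' W.asIdeal, ?_, fun k => ?_⟩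
  · exact Ideal.IsDedekindDomain.ramificationIdx'_ne_zero_of_liesOver _ 𝔭.ne_bot
  · exact (IsDedekindDomain.HeightOneSpectrum.valuation_liesOver E 𝔭 W k).symm

/-- If the critical orbit meets a prime above `d` to exact order one and `α` vanishes there to order
at least two, then the arboreal Galois group of `x ^ d + c` at `α` is nonabelian. -/
theorem exists_not_commute_of_valuation {A K : Type*} [CommRing A] [IsDedekindDomain A] [Field K]
    [CharZero K] [Algebra A K] [IsFractionRing A K] (𝔭 : IsDedekindDomain.HeightOneSpectrum A)
    {d n : ℕ} (hd : d.Prime) (hn : n ≠ 0) {ζ c α : K} (hζ : IsPrimitiveRoot ζ d)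
    (hvd : 𝔭.valuation K d < 1) (hc : 𝔭.valuation K c ≤ 1)
    (ha : 𝔭.valuation K (aSeq d c n) = exp (-1)) (hα : 𝔭.valuation K α ≤ exp (-2))
    (hn1 : n = 1 → 3 ≤ d) (hn2 : n ≠ 1 → 𝔭.valuation K c = 1) :
    ∃ σ τ : (fIter d c (n + 1) - C α).Gal, σ * τ ≠ τ * σ := by
  by_contra! hcomm
  set v := 𝔭.valuation K with hv
  set P := fIter d c (n + 1) - C α with hP
  let E := P.SplittingField
  have hcomm' : ∀ σ τ : E ≃ₐ[K] E, σ * τ = τ * σ := hcomm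
  have : IsGalois K E := ⟨⟩
  obtain ⟨w, e, he, hw⟩ := exists_valuation_extension (K := K) (E := E) 𝔭
  -- the valuation of `ζ - 1`
  have hζ1 : ζ - 1 ≠ 0 := sub_ne_zero.2 (hζ.ne_one hd.one_lt)
  have hvζ : v ζ = 1 := by
    have : v ζ ^ d = 1 := by rw [← map_pow, hζ.pow_eq_one, map_one]
    exact (pow_eq_one_iff.1 this).resolve_right hd.ne_zero
  have hvζ1 : v (ζ - 1) ≤ 1 := v.map_sub_le hvζ.le v.map_one.le
  have hζlt : v (ζ - 1) < 1 := by
    obtain ⟨r, hr, hpow⟩ := exists_one_add_pow_prime (w := v) hd hvζ1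
    rw [add_sub_cancel, hζ.pow_eq_one] at hpow
    have h1 : (ζ - 1) ^ d = -(d * (ζ - 1) * r) := by linear_combination -hpow
    have h2 : v (ζ - 1) ^ d < 1 := by
      rw [← map_pow, h1, Valuation.map_neg, map_mul, map_mul]
      exact (mul_le_of_le_one_right' hr).trans_lt ((mul_le_of_le_one_right' hvζ1).trans_lt hvd)
    exact (pow_lt_one_iff hd.ne_zero).1 h2
  have hdvd : ∀ k, k < d → v d ≤ v (ζ - 1) ^ k := by
    intro k hk
    obtain ⟨z, hz, hzd⟩ := hζ.self_sub_one_pow_dvd_order hk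
    have hz1 : v z ≤ 1 := by
      have hle : Algebra.adjoin ℤ {ζ} ≤ subalgebraOfSubring v.integer :=
        Algebra.adjoin_le (Set.singleton_subset_iff.2 hvζ.le)
      exact hle hz
    rw [hzd, map_mul, map_pow]
    exact mul_le_of_le_one_left' hz1
  obtain ⟨V', hV'⟩ := exists_exp_eq (v.ne_zero_iff.2 hζ1)
  obtain ⟨V, rfl⟩ : ∃ V, V' = -V := ⟨-V', by ring⟩
  have hV : 1 ≤ V := by
    rw [hV', ← exp_zero, exp_lt_exp] at hζlt; omega
  -- a root and its image
  have hmon := fIter_monic_natDegree hd.ne_zero c (n + 1)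
  have hPdeg : P.degree ≠ 0 := by
    have h1 : P.natDegree = d ^ (n + 1) := by rw [hP, natDegree_sub_C, hmon.2]
    have h2 : 0 < P.natDegree := by rw [h1]; exact pow_pos hd.pos _
    exact (natDegree_pos_iff_degree_pos.1 h2).ne'
  obtain ⟨γ, hγ⟩ : ∃ γ : E, (fIter d (algebraMap K E c) n).eval (γ ^ d + algebraMap K E c) =
      algebraMap K E α := by
    obtain ⟨γ, hγ⟩ := (SplittingField.splits P).exists_eval_eq_zero (by rwa [degree_map])
    refine ⟨γ, ?_⟩
    rw [← eval_fIter_succ', ← aeval_fIter, ← sub_eq_zero, ← aeval_C (x := γ), ← map_sub]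
    rwa [eval_map_algebraMap] at hγ
  obtain ⟨β, hβγ⟩ : ∃ β, β = γ ^ d + algebraMap K E c := ⟨_, rfl⟩
  rw [← hβγ] at hγ
  obtain ⟨b, hb, hβ, hD⟩ := exists_val_eq_exp (pow_ne_zero n hd.ne_zero) he
    (val_pow_eq_of_eval_fIter hd hw he hvd hc ha hα hγ)
  have hQm := fIter_monic_natDegree hd.ne_zero c n
  have hQm' : (fIter d c n - C α).Monic := by
    refine hQm.1.sub_of_left (degree_C_le.trans_lt ?_)
    rw [← natDegree_pos_iff_degree_pos, hQm.2]
    exact pow_pos hd.pos _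
  have hQd : (fIter d c n - C α).natDegree = d ^ n := by rw [natDegree_sub_C, hQm.2]
  have haev : ∀ x : E, aeval x (fIter d c n - C α) =
      (fIter d (algebraMap K E c) n).eval x - algebraMap K E α := by
    intro x; rw [map_sub, aeval_C, aeval_fIter]
  have hQ0 : aeval β (fIter d c n - C α) = 0 := by rw [haev, hγ, sub_self]
  have hmin := minpoly_eq_of_ramified hw hβ hb hD hQm' hQd hQ0
  have h_int : IsIntegral K β := ⟨_, hQm', hQ0⟩
  obtain ⟨σ, hσ⟩ : ∃ σ : E ≃ₐ[K] E, σ β = algebraMap K E ζ * β := by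
    refine minpoly.exists_algEquiv_of_root' h_int.isAlgebraic ?_
    rw [hmin, haev, ← hγ, sub_eq_zero]
    obtain ⟨n, rfl⟩ := Nat.exists_eq_succ_of_ne_zero hn
    rw [Nat.succ_eq_add_one, eval_fIter_succ', eval_fIter_succ', mul_pow, ← map_pow,
      hζ.pow_eq_one, map_one, one_mul]
  have hβd : γ ^ d = β - algebraMap K E c := by rw [hβγ]; ring
  have hβc : β - algebraMap K E c ≠ 0 := by
    rw [sub_ne_zero]
    intro h
    have h1 : w β = v c ^ e := by rw [h, hw]
    by_cases h1n : n = 1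
    · subst h1n
      rw [show aSeq d c 1 = c by simp [aSeq, hd.ne_zero]] at ha
      rw [hβ, ha, ← exp_nsmul, exp_inj, nsmul_eq_mul, ← hD] at h1
      have : (2 : ℤ) ≤ d := by exact_mod_cast hd.two_le
      push_cast at h1
      nlinarith
    · rw [hn2 h1n, one_pow, hβ, ← exp_zero, exp_inj] at h1
      omega
  have hγ0 : γ ≠ 0 := by
    rintro rfl
    rw [zero_pow hd.ne_zero] at hβd
    exact hβc hβd.symm
  have hx := mem_adjoin_of_commute hcomm' hd hζ hβd hγ0 σ
  have hxd : (σ γ / γ) ^ d =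
      (algebraMap K E ζ * β - algebraMap K E c) / (β - algebraMap K E c) := by
    rw [div_pow, ← map_pow, hβd, map_sub, hσ, AlgEquiv.commutes]
  by_cases h1n : n = 1
  · subst h1n
    have hd3 := hn1 rfl
    rw [show aSeq d c 1 = c by simp [aSeq, hd.ne_zero]] at ha
    refine not_pow_of_uniformizer hd hd3 (κ := α - c) hV hw hβ hb (by simpa using hD) ?_ hvζ.le
      (by rw [hmin, hQd, pow_one]) h_int hV' (hdvd 2 (by omega)) ha hx hxd
    rw [map_sub, ← hγ]; simp [fIter]
  · refine not_pow_of_unit hd hn hV hw hβ hb hD (by rw [hmin, hQd]) h_int hV' ?_ (hn2 h1n) hx hxd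
    simpa using hdvd 1 hd.one_lt


section Misiurewicz

open ArithmeticFunction (moebius)

lemma aPoly_map (d : ℕ) {R : Type*} [CommRing R] (k : ℕ) :
    (aPoly d k).map (Int.castRingHom R) = aSeq d (X : R[X]) k := by
  induction k with
  | zero => simp [aPoly, aSeq]
  | succ k ih => simp [aPoly, aSeq, ih]

lemma aSeq_X_map (d : ℕ) {R S : Type*} [CommRing R] [CommRing S] (φ : R →+* S) (k : ℕ) :
    (aSeq d (X : R[X]) k).map φ = aSeq d (X : S[X]) k := by
  rw [← coe_mapRingHom, aSeq_map, coe_mapRingHom, map_X]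

lemma eval_aSeq_X (d : ℕ) {R : Type*} [CommRing R] (c : R) (k : ℕ) :
    (aSeq d (X : R[X]) k).eval c = aSeq d c k := by
  rw [← coe_evalRingHom, aSeq_map, coe_evalRingHom, eval_X]

lemma aSeq_X_monic_natDegree {d : ℕ} (hd : 2 ≤ d) {R : Type*} [CommRing R] [Nontrivial R] (k : ℕ) :
    (aSeq d (X : R[X]) (k + 1)).Monic ∧ (aSeq d (X : R[X]) (k + 1)).natDegree = d ^ k := by
  induction k with
  | zero =>
    have h : aSeq d (X : R[X]) (0 + 1) = X := by simp [aSeq, show d ≠ 0 by omega]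
    rw [h]
    exact ⟨monic_X, by simp⟩
  | succ k ih =>
    have hm := ih.1.pow d
    have hdeg : (aSeq d (X : R[X]) (k + 1) ^ d).natDegree = d ^ (k + 1) := by
      rw [ih.1.natDegree_pow, ih.2, pow_succ']
    have hlt : (X : R[X]).natDegree < (aSeq d (X : R[X]) (k + 1) ^ d).natDegree := by
      rw [natDegree_X, hdeg]; exact Nat.one_lt_pow (by omega) (by omega)
    refine ⟨hm.add_of_left (degree_lt_degree hlt), ?_⟩
    rw [aSeq, natDegree_add_eq_left_of_natDegree_lt hlt, hdeg]

lemma aSeq_X_monic {d : ℕ} (hd : 2 ≤ d) {R : Type*} [CommRing R] {k : ℕ} (hk : k ≠ 0) :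
    (aSeq d (X : R[X]) k).Monic := by
  nontriviality R
  obtain ⟨k, rfl⟩ := Nat.exists_eq_succ_of_ne_zero hk
  exact (aSeq_X_monic_natDegree hd k).1

/-- The building blocks `a_{m+k-1} - z a_{m-1}` of the Misiurewicz polynomials. -/
def misiurewiczFactor (d m : ℕ) {R : Type*} [CommRing R] (z : R) (k : ℕ) : R[X] :=
  aSeq d X (m + k - 1) - C z * aSeq d X (m - 1)

/-- The numerator of the Misiurewicz polynomial. -/
def misiurewiczNum (d m n : ℕ) {R : Type*} [CommRing R] (z : R) : R[X] :=
  (∏ k ∈ n.divisors, misiurewiczFactor d m z k ^ (moebius (n / k)).toNat) *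
    if n ∣ m - 1 then ∏ k ∈ n.divisors, aSeq d X k ^ (-moebius (n / k)).toNat else 1

/-- The denominator of the Misiurewicz polynomial. -/
def misiurewiczDen (d m n : ℕ) {R : Type*} [CommRing R] (z : R) : R[X] :=
  (∏ k ∈ n.divisors, misiurewiczFactor d m z k ^ (-moebius (n / k)).toNat) *
    if n ∣ m - 1 then ∏ k ∈ n.divisors, aSeq d X k ^ (moebius (n / k)).toNat else 1

variable {d m n : ℕ} {R S : Type*} [CommRing R] [CommRing S]

lemma misiurewiczFactor_map (φ : R →+* S) (z : R) (k : ℕ) :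
    (misiurewiczFactor d m z k).map φ = misiurewiczFactor d m (φ z) k := by
  simp [misiurewiczFactor, aSeq_X_map]

lemma misiurewiczNum_map (φ : R →+* S) (z : R) :
    (misiurewiczNum d m n z).map φ = misiurewiczNum d m n (φ z) := by
  simp only [misiurewiczNum, Polynomial.map_mul, Polynomial.map_prod, Polynomial.map_pow,
    misiurewiczFactor_map]
  split_ifs <;> simp [Polynomial.map_prod, aSeq_X_map]

lemma misiurewiczDen_map (φ : R →+* S) (z : R) :
    (misiurewiczDen d m n z).map φ = misiurewiczDen d m n (φ z) := by
  simp only [misiurewiczDen, Polynomial.map_mul, Polynomial.map_prod, Polynomial.map_pow,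
    misiurewiczFactor_map]
  split_ifs <;> simp [Polynomial.map_prod, aSeq_X_map]

lemma misiurewiczFactor_monic (hd : 2 ≤ d) (hm : 2 ≤ m) (z : R) {k : ℕ} (hk : k ≠ 0) :
    (misiurewiczFactor d m z k).Monic := by
  nontriviality R
  obtain ⟨m, rfl⟩ := Nat.exists_eq_add_of_le' hm
  have h1 := aSeq_X_monic_natDegree (R := R) hd (m + k)
  have h2 := aSeq_X_monic_natDegree (R := R) hd m
  rw [misiurewiczFactor, show m + 2 + k - 1 = m + k + 1 by omega, show m + 2 - 1 = m + 1 by omega]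
  refine h1.1.sub_of_left (degree_lt_degree ?_)
  refine (natDegree_C_mul_le _ _).trans_lt ?_
  rw [h1.2, h2.2]
  exact Nat.pow_lt_pow_right (by omega) (by omega)

lemma misiurewiczNum_monic (hd : 2 ≤ d) (hm : 2 ≤ m) (z : R) : (misiurewiczNum d m n z).Monic := by
  have hne : ∀ k ∈ n.divisors, k ≠ 0 := fun k hk => (Nat.pos_of_mem_divisors hk).ne'
  refine Monic.mul (monic_prod_of_monic _ _ fun k hk =>
    (misiurewiczFactor_monic hd hm z (hne k hk)).pow _) ?_
  split_ifs
  · exact monic_prod_of_monic _ _ fun k hk => (aSeq_X_monic hd (hne k hk)).pow _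
  · exact monic_one

lemma misiurewiczDen_monic (hd : 2 ≤ d) (hm : 2 ≤ m) (z : R) : (misiurewiczDen d m n z).Monic := by
  have hne : ∀ k ∈ n.divisors, k ≠ 0 := fun k hk => (Nat.pos_of_mem_divisors hk).ne'
  refine Monic.mul (monic_prod_of_monic _ _ fun k hk =>
    (misiurewiczFactor_monic hd hm z (hne k hk)).pow _) ?_
  split_ifs
  · exact monic_prod_of_monic _ _ fun k hk => (aSeq_X_monic hd (hne k hk)).pow _
  · exact monic_one

/-- A Misiurewicz point is an algebraic integer, and the division defining the Misiurewicz
polynomial takes place over the ring of algebraic integers. -/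
lemma exists_integral_of_isMisiurewiczRoot (hd : 2 ≤ d) (hm : 2 ≤ m) {ζ c₀ : ℂ}
    (hζd : ζ ^ d = 1) (h : isMisiurewiczRoot d m n ζ c₀) :
    ∃ (z c : integralClosure ℤ ℂ) (g : (integralClosure ℤ ℂ)[X]),
      (z : ℂ) = ζ ∧ (c : ℂ) = c₀ ∧ g.Monic ∧
      g * misiurewiczDen d m n z = misiurewiczNum d m n z ∧ g.eval c = 0 := by
  obtain ⟨g, hg, hgc⟩ := h
  simp only [aPoly_map] at hg
  obtain ⟨z, rfl⟩ : ∃ z : integralClosure ℤ ℂ, (z : ℂ) = ζ :=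
    ⟨⟨ζ, X ^ d - C 1, monic_X_pow_sub_C _ (by omega), by simp [hζd]⟩, rfl⟩
  set φ := algebraMap (integralClosure ℤ ℂ) ℂ
  have hφ : Function.Injective φ := Subtype.val_injective
  change g * misiurewiczDen d m n (φ z) = misiurewiczNum d m n (φ z) at hg
  rw [← misiurewiczDen_map, ← misiurewiczNum_map] at hg
  have hden := misiurewiczDen_monic (n := n) hd hm z
  obtain ⟨g', hg'⟩ := (map_dvd_map φ hφ hden).1 ⟨g, by rw [← hg, mul_comm]⟩
  have hmon : g'.Monic := hden.of_mul_monic_left (hg' ▸ misiurewiczNum_monic hd hm z)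
  have hgg : g = g'.map φ := by
    apply (hden.map φ).isRegular.right
    simp only [hg]
    rw [hg', Polynomial.map_mul, mul_comm]
  subst hgg
  have h_int : IsIntegral ℤ c₀ := isIntegral_trans (A := integralClosure ℤ ℂ) c₀
    ⟨g', hmon, by rwa [eval_map] at hgc⟩
  refine ⟨z, ⟨c₀, h_int⟩, g', rfl, rfl, hmon, by rw [hg', mul_comm], hφ ?_⟩
  rw [map_zero, ← hgc, eval_map, ← eval₂_at_apply]
  rfl

end Misiurewicz

section MisiurewiczModPrime

open ArithmeticFunction (moebius)

lemma aSeq_add_of_natCast_eq_zero {d : ℕ} (hd : d.Prime) {F : Type*} [CommRing F]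
    (h0 : (d : F) = 0) (c : F) (i j : ℕ) :
    aSeq d c (i + j) = aSeq d c j ^ d ^ i + aSeq d c i := by
  obtain ⟨h, hh⟩ := exists_eval_fIter_eq hd c (aSeq d c j) i
  rw [← eval_fIter_aSeq, hh, h0]
  ring

lemma derivative_aSeq_X (d : ℕ) {R : Type*} [CommRing R] (k : ℕ) :
    derivative (aSeq d (X : R[X]) (k + 1)) =
      C (d : R) * aSeq d X k ^ (d - 1) * derivative (aSeq d X k) + 1 := by
  rw [aSeq, derivative_add, derivative_X, derivative_pow]

lemma rootMultiplicity_aSeq_X {d : ℕ} (hd : 2 ≤ d) {F : Type*} [CommRing F] [IsDomain F]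
    (h0 : (d : F) = 0) (c : F) {k : ℕ} (hk : k ≠ 0) [Decidable (aSeq d c k = 0)] :
    (aSeq d (X : F[X]) k).rootMultiplicity c = if aSeq d c k = 0 then 1 else 0 := by
  have hmon : (aSeq d (X : F[X]) k) ≠ 0 := (aSeq_X_monic hd hk).ne_zero
  split_ifs with h
  · have hr : (aSeq d (X : F[X]) k).IsRoot c := by rwa [IsRoot.def, eval_aSeq_X]
    refine le_antisymm ?_ ((rootMultiplicity_pos hmon).2 hr)
    by_contra! hlt
    have := (one_lt_rootMultiplicity_iff_isRoot hmon).1 hlt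
    obtain ⟨k, rfl⟩ := Nat.exists_eq_succ_of_ne_zero hk
    have h1 := this.2
    rw [Nat.succ_eq_add_one, derivative_aSeq_X, h0] at h1
    simp at h1
  · rw [rootMultiplicity_eq_zero_iff]
    intro hr
    rw [IsRoot.def, eval_aSeq_X] at hr
    exact absurd hr h

lemma aSeq_eq_zero_iff_dvd (d : ℕ) {F : Type*} [CommRing F] (c : F) (k : ℕ) :
    aSeq d c k = 0 ↔ Function.minimalPeriod (fun x : F => x ^ d + c) 0 ∣ k := by
  rw [← Function.isPeriodicPt_iff_minimalPeriod_dvd]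
  have : (fun x : F => x ^ d + c)^[k] 0 = aSeq d c k := by
    induction k with
    | zero => rfl
    | succ k ih => rw [Function.iterate_succ_apply', ih, aSeq]
  rw [Function.IsPeriodicPt, Function.IsFixedPt, this]

lemma sum_moebius_ite_dvd (r : ℕ) {n : ℕ} (hn : 0 < n) :
    ∑ k ∈ n.divisors, moebius (n / k) * (if r ∣ k then 1 else 0 : ℤ) = if n = r then 1 else 0 := by
  have key := (ArithmeticFunction.sum_eq_iff_sum_mul_moebius_eq (R := ℤ)
    (f := fun n => if n = r then 1 else 0) (g := fun n => if r ∣ n then 1 else 0)).1 (by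
      intro n hn
      rw [Finset.sum_ite_eq']
      simp [hn.ne']) n hn
  simp only [Int.cast_id] at key
  rw [← key, Nat.sum_divisorsAntidiagonal' (fun a b => moebius a * if r ∣ b then 1 else 0)]

lemma rootMultiplicity_prod {F ι : Type*} [CommRing F] [IsDomain F] (s : Finset ι) (f : ι → F[X])
    (hf : ∀ i ∈ s, f i ≠ 0) (c : F) :
    (∏ i ∈ s, f i).rootMultiplicity c = ∑ i ∈ s, (f i).rootMultiplicity c := by
  classical
  simp only [← count_roots]
  rw [roots_prod _ _ (Finset.prod_ne_zero_iff.2 hf), Multiset.count_bind]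
  rfl

lemma rootMultiplicity_pow' {F : Type*} [CommRing F] [IsDomain F] (p : F[X]) (k : ℕ) (c : F) :
    (p ^ k).rootMultiplicity c = k * p.rootMultiplicity c := by
  classical
  rw [← count_roots, roots_pow, Multiset.count_nsmul, count_roots]

/-- In characteristic `d`, the critical orbit at a root of the reduced Misiurewicz polynomial has
exact period `n`. -/
lemma aSeq_eq_zero_iff_of_misiurewicz {d m n : ℕ} (hd : d.Prime) (hm : 2 ≤ m) (hn : n ≠ 0)
    {F : Type*} [CommRing F] [IsDomain F] (h0 : (d : F) = 0) {g : F[X]} (hg : g.Monic)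
    (h : g * misiurewiczDen d m n (1 : F) = misiurewiczNum d m n 1) {c : F} (hc : g.eval c = 0)
    (k : ℕ) : aSeq d c k = 0 ↔ n ∣ k := by
  classical
  set r := Function.minimalPeriod (fun x : F => x ^ d + c) 0 with hr
  suffices n = r by rw [this, hr]; exact aSeq_eq_zero_iff_dvd d c k
  by_contra hnr
  have hfac : ∀ k, misiurewiczFactor d m (1 : F) k = aSeq d X k ^ d ^ (m - 1) := by
    intro k
    have h0' : (d : F[X]) = 0 := by rw [← C_eq_natCast, h0, C_0]
    rw [misiurewiczFactor, show m + k - 1 = m - 1 + k by omega,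
      aSeq_add_of_natCast_eq_zero hd h0', C_1]
    ring
  have hmult : ∀ k ∈ n.divisors, (aSeq d (X : F[X]) k).rootMultiplicity c =
      if r ∣ k then 1 else 0 := by
    intro k hk
    rw [rootMultiplicity_aSeq_X hd.two_le h0 c (Nat.pos_of_mem_divisors hk).ne']
    simp only [aSeq_eq_zero_iff_dvd, hr]
  have hne : ∀ k ∈ n.divisors, aSeq d (X : F[X]) k ≠ 0 := fun k hk =>
    (aSeq_X_monic hd.two_le (Nat.pos_of_mem_divisors hk).ne').ne_zero
  set A : ℕ := ∑ k ∈ n.divisors, (moebius (n / k)).toNat * (if r ∣ k then 1 else 0) with hA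
  set B : ℕ := ∑ k ∈ n.divisors, (-moebius (n / k)).toNat * (if r ∣ k then 1 else 0) with hB
  have hAB : A = B := by
    have h1 : (A : ℤ) - B = 0 := by
      have := sum_moebius_ite_dvd r (Nat.pos_of_ne_zero hn)
      rw [if_neg hnr] at this
      rw [← this, hA, hB]
      push_cast
      rw [← Finset.sum_sub_distrib]
      refine Finset.sum_congr rfl fun k _ => ?_
      rw [← sub_mul]
      congr 1
      omega
    omega
  have hprod : ∀ (e : ℕ → ℕ) (q : ℕ),
      (∏ k ∈ n.divisors, (aSeq d (X : F[X]) k ^ q) ^ e k).rootMultiplicity c =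
        q * ∑ k ∈ n.divisors, e k * (if r ∣ k then 1 else 0) := by
    intro e q
    rw [rootMultiplicity_prod _ _ fun k hk => pow_ne_zero _ (pow_ne_zero _ (hne k hk)),
      Finset.mul_sum]
    refine Finset.sum_congr rfl fun k hk => ?_
    rw [rootMultiplicity_pow', rootMultiplicity_pow', hmult k hk]
    ring
  have hNum : (misiurewiczNum d m n (1 : F)).rootMultiplicity c =
      d ^ (m - 1) * A + if n ∣ m - 1 then B else 0 := by
    rw [misiurewiczNum, rootMultiplicity_mul (misiurewiczNum_monic hd.two_le hm 1).ne_zero]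
    simp only [hfac, hprod]
    split_ifs
    · have := hprod (fun k => (-moebius (n / k)).toNat) 1
      simp only [pow_one, one_mul] at this
      rw [this]
    · rw [← C_1, rootMultiplicity_C]
  have hDen : (misiurewiczDen d m n (1 : F)).rootMultiplicity c =
      d ^ (m - 1) * B + if n ∣ m - 1 then A else 0 := by
    rw [misiurewiczDen, rootMultiplicity_mul (misiurewiczDen_monic hd.two_le hm 1).ne_zero]
    simp only [hfac, hprod]
    split_ifs
    · have := hprod (fun k => (moebius (n / k)).toNat) 1
      simp only [pow_one, one_mul] at this
      rw [this]
    · rw [← C_1, rootMultiplicity_C]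
  have hpos := (rootMultiplicity_pos hg.ne_zero).2 hc
  have hmul := congrArg (rootMultiplicity c) h
  rw [rootMultiplicity_mul (h ▸ (misiurewiczNum_monic hd.two_le hm 1).ne_zero), hNum, hDen,
    hAB] at hmul
  omega

end MisiurewiczModPrime

section MisiurewiczPoint

open ArithmeticFunction (moebius)

variable {d m n : ℕ} {R : Type*} [CommRing R]

lemma sub_one_mem_of_pow_eq_one (hd : d.Prime) {𝔔 : Ideal R} [h𝔔 : 𝔔.IsPrime]
    (hd𝔔 : (d : R) ∈ 𝔔) {z : R} (hz : z ^ d = 1) : z - 1 ∈ 𝔔 := by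
  obtain ⟨r, hr⟩ := exists_add_pow_prime_eq hd 1 (z - 1)
  refine h𝔔.mem_of_pow_mem d ?_
  have h : (z - 1) ^ d = -(d * (1 * (z - 1) * r)) := by
    rw [add_sub_cancel, hz] at hr
    linear_combination -hr
  rw [h]
  exact 𝔔.neg_mem (𝔔.mul_mem_right _ hd𝔔)

lemma aSeq_mem_iff_dvd (hd : d.Prime) (hm : 2 ≤ m) (hn : n ≠ 0) {𝔔 : Ideal R} [h𝔔 : 𝔔.IsPrime]
    (hd𝔔 : (d : R) ∈ 𝔔) {z c : R} (hz : z ^ d = 1) {g : R[X]} (hg : g.Monic)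
    (h : g * misiurewiczDen d m n z = misiurewiczNum d m n z) (hc : g.eval c = 0) (k : ℕ) :
    aSeq d c k ∈ 𝔔 ↔ n ∣ k := by
  set π := Ideal.Quotient.mk 𝔔
  have hz1 : π z = 1 := by
    rw [← map_one π, Ideal.Quotient.eq]
    exact sub_one_mem_of_pow_eq_one hd hd𝔔 hz
  have h0 : (d : R ⧸ 𝔔) = 0 := by
    rw [← map_natCast π, Ideal.Quotient.eq_zero_iff_mem]
    exact hd𝔔
  have h' := congrArg (Polynomial.map π) h
  rw [Polynomial.map_mul, misiurewiczDen_map, misiurewiczNum_map, hz1] at h'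
  rw [← Ideal.Quotient.eq_zero_iff_mem, aSeq_map]
  refine aSeq_eq_zero_iff_of_misiurewicz hd hm hn h0 (hg.map π) h' ?_ k
  rw [eval_map, eval₂_at_apply, hc, map_zero]

/-- At a Misiurewicz point, all factors of the numerator other than the main one are units at a
prime above `d`. -/
lemma exists_misiurewiczNum_eq (hd : d.Prime) (hm : 2 ≤ m) (hn : n ≠ 0) {𝔔 : Ideal R}
    [h𝔔 : 𝔔.IsPrime] (hd𝔔 : (d : R) ∈ 𝔔) {z c : R} (hz : z ^ d = 1)
    (hmem : ∀ k, aSeq d c k ∈ 𝔔 ↔ n ∣ k) :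
    ∃ T : R[X], misiurewiczNum d m n z = misiurewiczFactor d m z n * T ∧ T.eval c ∉ 𝔔 := by
  have hprod : ∀ (s : Finset ℕ) (f : ℕ → R), (∀ k ∈ s, f k ∉ 𝔔) → ∏ k ∈ s, f k ∉ 𝔔 := by
    intro s f hf hs
    obtain ⟨k, hk, hk'⟩ := h𝔔.prod_mem_iff.1 hs
    exact hf k hk hk'
  have hpow : ∀ (x : R) (e : ℕ), x ∉ 𝔔 → x ^ e ∉ 𝔔 := fun x e hx h => hx (h𝔔.mem_of_pow_mem e h)
  have hne : ∀ k ∈ n.divisors, k ≠ n → ¬ n ∣ k := fun k hk hkn hnk =>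
    hkn (Nat.dvd_antisymm (Nat.dvd_of_mem_divisors hk) hnk)
  have hfac : ∀ k, (misiurewiczFactor d m z k).eval c ∈ 𝔔 → n ∣ k := by
    intro k hk
    obtain ⟨h, hh⟩ := exists_eval_fIter_eq hd c (aSeq d c k) (m - 1)
    rw [eval_fIter_aSeq] at hh
    rw [misiurewiczFactor, eval_sub, eval_mul, eval_C, eval_aSeq_X, eval_aSeq_X,
      show m + k - 1 = m - 1 + k by omega, hh] at hk
    rw [← hmem]
    refine h𝔔.mem_of_pow_mem (d ^ (m - 1)) ?_
    have h1 := 𝔔.mul_mem_right (aSeq d c (m - 1)) (sub_one_mem_of_pow_eq_one hd hd𝔔 hz)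
    have h2 := 𝔔.mul_mem_right (aSeq d c k * h) hd𝔔
    convert 𝔔.sub_mem (𝔔.add_mem hk h1) h2 using 1
    ring
  have hnn : n ∈ n.divisors := Nat.mem_divisors_self n hn
  have h1 : moebius (n / n) = 1 := by
    rw [Nat.div_self (Nat.pos_of_ne_zero hn)]; exact ArithmeticFunction.moebius_apply_one
  refine ⟨(∏ k ∈ n.divisors.erase n, misiurewiczFactor d m z k ^ (moebius (n / k)).toNat) *
    if n ∣ m - 1 then ∏ k ∈ n.divisors, aSeq d X k ^ (-moebius (n / k)).toNat else 1, ?_, ?_⟩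
  · rw [misiurewiczNum, ← Finset.mul_prod_erase _ _ hnn, h1, Int.toNat_one, pow_one, mul_assoc]
  · rw [eval_mul]
    refine h𝔔.mul_notMem ?_ ?_
    · rw [eval_prod]
      refine hprod _ _ fun k hk => ?_
      rw [Finset.mem_erase] at hk
      rw [eval_pow]
      exact hpow _ _ fun h => hne k hk.2 hk.1 (hfac k h)
    · split_ifs
      · rw [eval_prod]
        refine hprod _ _ fun k hk => ?_
        rw [eval_pow, eval_aSeq_X]
        by_cases hkn : k = n
        · rw [hkn, h1, show (-1 : ℤ).toNat = 0 by rfl, pow_zero]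
          exact fun h => h𝔔.ne_top ((Ideal.eq_top_iff_one _).2 h)
        · exact hpow _ _ fun h => hne k hk hkn ((hmem k).1 h)
      · rw [eval_one]
        exact fun h => h𝔔.ne_top ((Ideal.eq_top_iff_one _).2 h)

/-- The critical orbit at a Misiurewicz point satisfies the expected relation, and the critical
point is strictly preperiodic. -/
lemma aSeq_relation_of_misiurewicz [IsDomain R] (hd : d.Prime) (hm : 2 ≤ m) (hn : n ≠ 0)
    {𝔔 : Ideal R} [h𝔔 : 𝔔.IsPrime] (hd𝔔 : (d : R) ∈ 𝔔) {z c : R} (hz : z ^ d = 1) (hz1 : z ≠ 1)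
    {g : R[X]} (h : g * misiurewiczDen d m n z = misiurewiczNum d m n z)
    (hc : g.eval c = 0) (hmem : ∀ k, aSeq d c k ∈ 𝔔 ↔ n ∣ k) :
    aSeq d c (m - 1 + n) = z * aSeq d c (m - 1) ∧ aSeq d c n ≠ 0 := by
  obtain ⟨T, hT, hTc⟩ := exists_misiurewiczNum_eq hd hm hn hd𝔔 hz hmem
  have hTc0 : T.eval c ≠ 0 := fun h0 => hTc (h0 ▸ 𝔔.zero_mem)
  have hrel : aSeq d c (m - 1 + n) = z * aSeq d c (m - 1) := by
    have h1 := congrArg (eval c) h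
    rw [hT, eval_mul, hc, zero_mul, eval_mul] at h1
    have h2 := (mul_eq_zero.1 h1.symm).resolve_right hTc0
    rw [misiurewiczFactor, eval_sub, eval_mul, eval_C, eval_aSeq_X, eval_aSeq_X, sub_eq_zero,
      show m + n - 1 = m - 1 + n by omega] at h2
    exact h2
  refine ⟨hrel, fun ha => ?_⟩
  have hper : ∀ i, aSeq d c (i + n) = aSeq d c i := fun i => by
    rw [← eval_fIter_aSeq, ha, eval_fIter_zero]
  have hz1' : 1 - z ≠ 0 := sub_ne_zero.2 hz1.symm
  have hm0 : aSeq d c (m - 1) = 0 := by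
    rw [hper] at hrel
    exact (mul_eq_zero.1 (show (1 - z) * aSeq d c (m - 1) = 0 by
      linear_combination hrel)).resolve_left hz1'
  have hnm : n ∣ m - 1 := (hmem _).1 (hm0 ▸ 𝔔.zero_mem)
  have hden : (misiurewiczDen d m n z).eval c = 0 := by
    rw [misiurewiczDen, if_pos hnm, eval_mul]
    refine mul_eq_zero_of_right _ ?_
    rw [eval_prod]
    refine Finset.prod_eq_zero (Nat.mem_divisors_self n hn) ?_
    rw [eval_pow, eval_aSeq_X, ha, Nat.div_self (Nat.pos_of_ne_zero hn)]
    simp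
  have hfac : (misiurewiczFactor d m z n).eval c = 0 := by
    rw [misiurewiczFactor, eval_sub, eval_mul, eval_C, eval_aSeq_X, eval_aSeq_X, sub_eq_zero,
      show m + n - 1 = m - 1 + n by omega, hrel]
  have hder : (derivative (misiurewiczFactor d m z n)).eval c = 0 := by
    have h1 := congrArg (fun p => (derivative p).eval c) h
    simp only [hT, derivative_mul, eval_add, eval_mul, hc, hden, hfac, mul_zero, zero_mul,
      add_zero] at h1
    exact (mul_eq_zero.1 h1.symm).resolve_right hTc0
  have hdper : ∀ i, (derivative (aSeq d (X : R[X]) (i + 1 + n))).eval c =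
      (derivative (aSeq d (X : R[X]) (i + 1))).eval c := by
    intro i
    induction i with
    | zero =>
      rw [show 0 + 1 + n = n + 1 by omega, derivative_aSeq_X, derivative_aSeq_X]
      simp [eval_aSeq_X, ha, aSeq, zero_pow (show d - 1 ≠ 0 by have := hd.two_le; omega)]
    | succ i ih =>
      rw [show i + 1 + 1 + n = i + 1 + n + 1 by omega, derivative_aSeq_X, derivative_aSeq_X]
      simp only [eval_add, eval_mul, eval_pow, eval_aSeq_X, hper, ih]
  obtain ⟨m, rfl⟩ := Nat.exists_eq_add_of_le' hm
  rw [misiurewiczFactor, show m + 2 + n - 1 = m + 1 + n by omega,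
    show m + 2 - 1 = m + 1 by omega, derivative_sub, derivative_C_mul, eval_sub, eval_mul, eval_C,
    hdper] at hder
  have hδ : (derivative (aSeq d (X : R[X]) (m + 1))).eval c = 0 :=
    (mul_eq_zero.1 (show (1 - z) * (derivative (aSeq d (X : R[X]) (m + 1))).eval c = 0 by
      linear_combination hder)).resolve_left hz1'
  rw [derivative_aSeq_X] at hδ
  simp only [eval_add, eval_mul, eval_C, eval_one] at hδ
  refine h𝔔.ne_top ((Ideal.eq_top_iff_one _).2 ?_)
  rw [← neg_eq_of_add_eq_zero_right hδ]
  exact 𝔔.neg_mem (𝔔.mul_mem_right _ (𝔔.mul_mem_right _ hd𝔔))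

end MisiurewiczPoint

section CriticalValuation

lemma pow_dvd_aSeq_add_sub (d : ℕ) {R : Type*} [CommRing R] (c : R) {i : ℕ} (hi : i ≠ 0) (j : ℕ) :
    aSeq d c j ^ d ∣ aSeq d c (i + j) - aSeq d c i := by
  obtain ⟨i, rfl⟩ := Nat.exists_eq_succ_of_ne_zero hi
  rw [← eval_fIter_aSeq, ← eval_fIter_zero d c (i + 1), eval_fIter_succ', eval_fIter_succ']
  by_cases hd : d = 0
  · simp [hd]
  · refine dvd_trans ?_ (sub_dvd_eval_sub _ _ _)
    simp [zero_pow hd]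

lemma exists_aSeq_mul_eq {d : ℕ} (hd : 2 ≤ d) {R : Type*} [CommRing R] (c : R) {n : ℕ} (hn : n ≠ 0)
    (j : ℕ) : ∃ h, aSeq d c (n * (j + 1)) = aSeq d c n * (1 + aSeq d c n * h) := by
  induction j with
  | zero => exact ⟨0, by simp⟩
  | succ j ih =>
    obtain ⟨h, hh⟩ := ih
    obtain ⟨s, hs⟩ := pow_dvd_aSeq_add_sub d c hn (n * (j + 1))
    obtain ⟨q, rfl⟩ := Nat.exists_eq_add_of_le' hd
    refine ⟨(aSeq (q + 2) c n * (1 + aSeq (q + 2) c n * h)) ^ q *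
      (1 + aSeq (q + 2) c n * h) ^ 2 * s, ?_⟩
    rw [show n * (j + 1 + 1) = n + n * (j + 1) by ring, ← sub_eq_zero]
    rw [hh, pow_add] at hs
    linear_combination hs

variable {K : Type*} [Field K] (v : Valuation K ℤᵐ⁰) (c : K)

/-- The ring of fractions `F(c) / H(c)` with `F`, `H` integer polynomials and `H(c)` a unit. -/
def unitFractions : Subring K where
  carrier := {y | ∃ F H : ℤ[X], v (aeval c H) = 1 ∧ y * aeval c H = aeval c F}
  mul_mem' := by
    rintro y y' ⟨F, H, hH, h⟩ ⟨F', H', hH', h'⟩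
    refine ⟨F * F', H * H', by rw [map_mul, map_mul, hH, hH', one_mul], ?_⟩
    rw [map_mul, map_mul, ← h, ← h']; ring
  one_mem' := ⟨1, 1, by simp, by simp⟩
  add_mem' := by
    rintro y y' ⟨F, H, hH, h⟩ ⟨F', H', hH', h'⟩
    refine ⟨F * H' + F' * H, H * H', by rw [map_mul, map_mul, hH, hH', one_mul], ?_⟩
    rw [map_mul, map_add, map_mul, map_mul, ← h, ← h']; ring
  zero_mem' := ⟨0, 1, by simp, by simp⟩
  neg_mem' := by
    rintro y ⟨F, H, hH, h⟩
    exact ⟨-F, H, hH, by rw [map_neg, ← h, neg_mul]⟩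

variable {v c}

lemma aeval_mem_unitFractions (F : ℤ[X]) : aeval c F ∈ unitFractions v c :=
  ⟨F, 1, by simp, by simp⟩

lemma aSeq_eq_aeval (d : ℕ) {R : Type*} [CommRing R] (c : R) (k : ℕ) :
    aSeq d c k = aeval c (aSeq d (X : ℤ[X]) k) := by
  have := aSeq_map d (aeval (R := ℤ) c).toRingHom (X : ℤ[X]) k
  simpa using this.symm

lemma aSeq_mem_unitFractions (d k : ℕ) : aSeq d c k ∈ unitFractions v c := by
  rw [aSeq_eq_aeval]; exact aeval_mem_unitFractions _

lemma val_aeval_le_one (hc : v c ≤ 1) (F : ℤ[X]) : v (aeval c F) ≤ 1 := by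
  have : aeval c F ∈ v.integer := by
    rw [aeval_eq_sum_range]
    refine sum_mem fun i _ => ?_
    rw [zsmul_eq_mul]
    exact mul_mem (intCast_mem _ _) (pow_mem hc _)
  exact this

lemma val_le_one_of_mem_unitFractions (hc : v c ≤ 1) {y : K} (hy : y ∈ unitFractions v c) :
    v y ≤ 1 := by
  obtain ⟨F, H, hH, h⟩ := hy
  have h1 := val_aeval_le_one hc F
  rwa [← h, map_mul, hH, mul_one] at h1

lemma inv_mem_unitFractions {y : K} (hy : y ∈ unitFractions v c) (hy1 : v y = 1) :
    y⁻¹ ∈ unitFractions v c := by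
  obtain ⟨F, H, hH, h⟩ := hy
  have hy0 : y ≠ 0 := by rintro rfl; simp at hy1
  refine ⟨H, F, by rw [← h, map_mul, hy1, hH, one_mul], ?_⟩
  rw [← h, inv_mul_cancel_left₀ hy0]

lemma exists_eq_natCast_mul_of_map_eq_zero {d : ℕ} {F : ℤ[X]}
    (h : F.map (Int.castRingHom (ZMod d)) = 0) : ∃ E, F = d * E := by
  have : C (d : ℤ) ∣ F := by
    rw [C_dvd_iff_dvd_coeff]
    intro i
    rw [← ZMod.intCast_zmod_eq_zero_iff_dvd, ← eq_intCast (Int.castRingHom (ZMod d)), ← coeff_map, h,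
      coeff_zero]
  simpa [dvd_def] using this

/-- An integer polynomial expression in `c` of positive valuation is a multiple of `a_n(c)`, up to
units, provided that `d` is: this uses that `a_n` is separable modulo `d`. -/
lemma exists_aeval_eq_mul {d n : ℕ} (hd : d.Prime) (hn : n ≠ 0) (hvd : v (d : K) < 1)
    (hc : v c ≤ 1) (ha : v (aSeq d c n) < 1) {s : K} (hs : s ∈ unitFractions v c)
    (hds : (d : K) = aSeq d c n * s) {F : ℤ[X]} (hF : v (aeval c F) < 1) :
    ∃ y ∈ unitFractions v c, aeval c F = aSeq d c n * y := by
  have : Fact d.Prime := ⟨hd⟩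
  let I : Ideal ℤ[X] :=
    { carrier := {F | v (aeval c F) < 1}
      add_mem' := fun {a b} ha hb => by
        simp only [Set.mem_ofPred_eq, map_add] at *; exact v.map_add_lt ha hb
      zero_mem' := by simp
      smul_mem' := fun a b hb => by
        simp only [Set.mem_ofPred_eq, smul_eq_mul, map_mul] at *
        exact (mul_le_of_le_one_left' (val_aeval_le_one hc a)).trans_lt hb }
  have hdI : (d : ℤ[X]) ∈ I := by change v (aeval c (d : ℤ[X])) < 1; simpa using hvd
  have hFI : F ∈ I := hF
  have hAI : aSeq d (X : ℤ[X]) n ∈ I := by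
    change v (aeval c (aSeq d (X : ℤ[X]) n)) < 1; rwa [← aSeq_eq_aeval]
  have h1I : (1 : ℤ[X]) ∉ I := by change ¬ v (aeval c (1 : ℤ[X])) < 1; simp
  set A := aSeq d (X : ℤ[X]) n with hA
  set φ := Int.castRingHom (ZMod d)
  have hφ : Function.Surjective (Polynomial.map φ) := map_surjective φ (ZMod.ringHom_surjective φ)
  have hmemI : ∀ P Q : ℤ[X], P.map φ = Q.map φ → Q ∈ I → P ∈ I := by
    intro P Q hPQ hQ
    obtain ⟨E, hE⟩ := exists_eq_natCast_mul_of_map_eq_zero (d := d) (F := P - Q)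
      (by rw [Polynomial.map_sub, hPQ, sub_self])
    rw [← sub_add_cancel P Q, hE]
    exact I.add_mem (I.mul_mem_right _ hdI) hQ
  obtain ⟨Γ, hΓ⟩ := hφ (EuclideanDomain.gcd (F.map φ) (A.map φ))
  obtain ⟨Δ', hΔ'⟩ := EuclideanDomain.gcd_dvd_right (F.map φ) (A.map φ)
  obtain ⟨Φ', hΦ'⟩ := EuclideanDomain.gcd_dvd_left (F.map φ) (A.map φ)
  obtain ⟨Δ, rfl⟩ := hφ Δ'
  obtain ⟨Φ, rfl⟩ := hφ Φ'
  have hΓI : Γ ∈ I := by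
    obtain ⟨u, hu⟩ := hφ (EuclideanDomain.gcdA (F.map φ) (A.map φ))
    obtain ⟨w, hw⟩ := hφ (EuclideanDomain.gcdB (F.map φ) (A.map φ))
    refine hmemI Γ (F * u + A * w) ?_ (I.add_mem (I.mul_mem_right _ hFI) (I.mul_mem_right _ hAI))
    rw [hΓ, EuclideanDomain.gcd_eq_gcd_ab, ← hu, ← hw]
    simp
  have hΔI : Δ ∉ I := by
    intro hΔI
    refine h1I (hmemI 1 (derivative (Γ * Δ)) ?_ ?_)
    · rw [← derivative_map, Polynomial.map_mul, hΓ, ← hΔ', hA, aSeq_X_map]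
      obtain ⟨n, rfl⟩ := Nat.exists_eq_succ_of_ne_zero hn
      simp [derivative_aSeq_X]
    · rw [derivative_mul]
      exact I.add_mem (I.mul_mem_left _ hΔI) (I.mul_mem_right _ hΓI)
  have hΔ1 : v (aeval c Δ) = 1 := (val_aeval_le_one hc Δ).antisymm (not_lt.1 hΔI)
  have hΔ0 : aeval c Δ ≠ 0 := by intro h; simp [h] at hΔ1
  obtain ⟨E, hE⟩ := exists_eq_natCast_mul_of_map_eq_zero (d := d) (F := Δ * F - A * Φ) (by
    simp only [Polynomial.map_sub, Polynomial.map_mul]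
    linear_combination Δ.map φ * hΦ' - Φ.map φ * hΔ')
  refine ⟨(aeval c Φ + s * aeval c E) * (aeval c Δ)⁻¹, ?_, ?_⟩
  · exact mul_mem (add_mem (aeval_mem_unitFractions _)
      (mul_mem hs (aeval_mem_unitFractions _)))
      (inv_mem_unitFractions (aeval_mem_unitFractions _) hΔ1)
  · have h1 := congrArg (aeval c) hE
    simp only [map_sub, map_mul, hA, ← aSeq_eq_aeval, map_natCast] at h1
    rw [hds] at h1
    rw [← mul_assoc, eq_mul_inv_iff_mul_eq₀ hΔ0]
    linear_combination h1

lemma exists_eq_mul_of_val_lt_one {d n : ℕ} (hd : d.Prime) (hn : n ≠ 0) (hvd : v (d : K) < 1)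
    (hc : v c ≤ 1) (ha : v (aSeq d c n) < 1) {s : K} (hs : s ∈ unitFractions v c)
    (hds : (d : K) = aSeq d c n * s) {x : K} (hx : x ∈ unitFractions v c) (hx1 : v x < 1) :
    ∃ y ∈ unitFractions v c, x = aSeq d c n * y := by
  obtain ⟨F, H, hH, h⟩ := hx
  have hH0 : aeval c H ≠ 0 := by intro h; simp [h] at hH
  obtain ⟨y, hy, hFy⟩ := exists_aeval_eq_mul hd hn hvd hc ha hs hds (F := F)
    (by rwa [← h, map_mul, hH, mul_one])
  refine ⟨y * (aeval c H)⁻¹, mul_mem hy (inv_mem_unitFractions (aeval_mem_unitFractions _) hH), ?_⟩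
  rw [← mul_assoc, eq_mul_inv_iff_mul_eq₀ hH0, h, hFy]

/-- If every element of `K` is a quotient of integer polynomials in `c` and `d` is a multiple of
`a_n(c)`, then the valuation of `a_n(c)` generates the value group. -/
lemma exists_val_eq_zpow {d n : ℕ} (hd : d.Prime) (hn : n ≠ 0) (hvd : v (d : K) < 1)
    (hc : v c ≤ 1) (ha : v (aSeq d c n) < 1) (ha0 : aSeq d c n ≠ 0) {s : K}
    (hs : s ∈ unitFractions v c) (hds : (d : K) = aSeq d c n * s)
    (hK : ∀ x : K, ∃ F H : ℤ[X], aeval c H ≠ 0 ∧ x * aeval c H = aeval c F) {x : K} (hx : x ≠ 0) :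
    ∃ j : ℤ, v x = v (aSeq d c n) ^ j := by
  obtain ⟨l', hl'⟩ := exists_exp_eq (v.ne_zero_iff.2 ha0)
  obtain ⟨l, rfl⟩ : ∃ l, l' = -l := ⟨-l', by ring⟩
  have hl : 0 < l := by
    rw [hl', ← exp_zero, exp_lt_exp] at ha; omega
  have key : ∀ (i : ℕ) (y : K), y ∈ unitFractions v c → v y = exp (-(i : ℤ)) →
      ∃ j : ℤ, v y = v (aSeq d c n) ^ j := by
    intro i
    induction i using Nat.strong_induction_on with
    | _ i ih =>
      intro y hy hyi
      by_cases hi : i = 0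
      · exact ⟨0, by rw [hyi, hi]; simp⟩
      obtain ⟨u, hu, rfl⟩ := exists_eq_mul_of_val_lt_one hd hn hvd hc ha hs hds hy
        (by rw [hyi, ← exp_zero, exp_lt_exp]; omega)
      have hu0 : u ≠ 0 := by
        rintro rfl
        rw [mul_zero, map_zero] at hyi
        exact exp_ne_zero hyi.symm
      obtain ⟨p, hp⟩ := exists_exp_eq (v.ne_zero_iff.2 hu0)
      have hp0 : p ≤ 0 := by
        have := val_le_one_of_mem_unitFractions hc hu
        rwa [hp, ← exp_zero, exp_le_exp] at this
      rw [map_mul, hl', hp, ← exp_add, exp_inj] at hyi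
      obtain ⟨j, hj⟩ := ih p.natAbs (by omega) u hu (by rw [hp]; congr 1; omega)
      refine ⟨j + 1, ?_⟩
      rw [map_mul, hj, zpow_add_one₀ (v.ne_zero_iff.2 ha0), mul_comm]
  have key' : ∀ F : ℤ[X], aeval c F ≠ 0 → ∃ j : ℤ, v (aeval c F) = v (aSeq d c n) ^ j := by
    intro F hF
    obtain ⟨p, hp⟩ := exists_exp_eq (v.ne_zero_iff.2 hF)
    have hp0 : p ≤ 0 := by
      have := val_aeval_le_one hc F
      rwa [hp, ← exp_zero, exp_le_exp] at this
    exact key p.natAbs _ (aeval_mem_unitFractions F) (by rw [hp]; congr 1; omega)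
  obtain ⟨F, H, hH, h⟩ := hK x
  obtain ⟨i, hi⟩ := key' F (by rw [← h]; exact mul_ne_zero hx hH)
  obtain ⟨j, hj⟩ := key' H hH
  refine ⟨i - j, ?_⟩
  rw [zpow_sub₀ (v.ne_zero_iff.2 ha0), ← hi, ← hj, ← h, map_mul,
    mul_div_cancel_right₀ _ (v.ne_zero_iff.2 hH)]

lemma sub_one_eq_aSeq_mul {d m n : ℕ} (hd : d.Prime) (hm : 2 ≤ m) (hn : n ≠ 0)
    (ha0 : aSeq d c n ≠ 0) (hc : v c ≤ 1) (ha : ∀ k, v (aSeq d c k) < 1 ↔ n ∣ k) {t : K}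
    (ht : aSeq d c (m - 1 + n) = t * aSeq d c (m - 1)) :
    ∃ s ∈ unitFractions v c, t - 1 = aSeq d c n * s := by
  obtain ⟨h, hh⟩ := pow_dvd_aSeq_add_sub d (X : ℤ[X]) (show m - 1 ≠ 0 by omega) n
  replace hh := congrArg (aeval c) hh
  simp only [map_sub, map_mul, map_pow, ← aSeq_eq_aeval] at hh
  obtain ⟨q, hq⟩ := Nat.exists_eq_add_of_le' hd.two_le
  have hpow : aSeq d c n ^ d = aSeq d c n * (aSeq d c n * aSeq d c n ^ q) := by
    nth_rewrite 2 [hq]; ring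
  rw [ht, hpow] at hh
  by_cases hnm : n ∣ m - 1
  · obtain ⟨j, hj⟩ := hnm
    obtain ⟨j, rfl⟩ := Nat.exists_eq_succ_of_ne_zero (show j ≠ 0 by rintro rfl; omega)
    obtain ⟨r, hr⟩ := exists_aSeq_mul_eq hd.two_le (X : ℤ[X]) hn j
    rw [← Nat.succ_eq_add_one, ← hj] at hr
    replace hr := congrArg (aeval c) hr
    simp only [map_mul, map_add, map_one, ← aSeq_eq_aeval] at hr
    have hu : 1 + aSeq d c n * aeval c r ∈ unitFractions v c :=
      add_mem (one_mem _) (mul_mem (aSeq_mem_unitFractions d n) (aeval_mem_unitFractions r))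
    have hu1 : v (1 + aSeq d c n * aeval c r) = 1 := by
      rw [v.map_one_add_of_lt]
      rw [map_mul]
      exact (mul_le_of_le_one_right' (val_aeval_le_one hc r)).trans_lt ((ha n).2 dvd_rfl)
    have hu0 : 1 + aSeq d c n * aeval c r ≠ 0 := by intro h; simp [h] at hu1
    refine ⟨aSeq d c n ^ q * aeval c h * (1 + aSeq d c n * aeval c r)⁻¹,
      mul_mem (mul_mem (pow_mem (aSeq_mem_unitFractions d n) q) (aeval_mem_unitFractions h))
        (inv_mem_unitFractions hu hu1), ?_⟩
    rw [← mul_assoc, eq_mul_inv_iff_mul_eq₀ hu0]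
    apply mul_left_cancel₀ ha0
    rw [hr] at hh
    linear_combination hh
  · have hu1 : v (aSeq d c (m - 1)) = 1 := by
      refine (not_lt.1 fun h => hnm ((ha _).1 h)).antisymm' ?_
      rw [aSeq_eq_aeval]
      exact val_aeval_le_one hc _
    have hu0 : aSeq d c (m - 1) ≠ 0 := by intro h; simp [h] at hu1
    refine ⟨aSeq d c n * aSeq d c n ^ q * aeval c h * (aSeq d c (m - 1))⁻¹,
      mul_mem (mul_mem (mul_mem (aSeq_mem_unitFractions d n)
        (pow_mem (aSeq_mem_unitFractions d n) q)) (aeval_mem_unitFractions h))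
        (inv_mem_unitFractions (aSeq_mem_unitFractions d _) hu1), ?_⟩
    rw [← mul_assoc, eq_mul_inv_iff_mul_eq₀ hu0]
    linear_combination hh

/-- If `t ≠ 1` is a `d`-th root of unity in a subring, then `t - 1` divides `d`. -/
lemma exists_natCast_eq_sub_one_mul {d : ℕ} {S : Subring K} {t : K} (ht : t ∈ S) (ht1 : t ≠ 1)
    (htd : t ^ d = 1) : ∃ s ∈ S, (d : K) = (t - 1) * s := by
  obtain ⟨s, hs⟩ := sub_dvd_eval_sub (⟨t, ht⟩ : S) 1 (∑ i ∈ Finset.range d, X ^ i)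
  replace hs := congrArg S.subtype hs
  simp only [eval_finsetSum, eval_pow, eval_X, one_pow, Finset.sum_const, Finset.card_range,
    map_sub, map_mul, map_sum, map_pow, Subring.subtype_apply, map_one, nsmul_eq_mul, mul_one,
    map_natCast, geom_sum_eq ht1, htd, sub_self, zero_div] at hs
  exact ⟨-s, S.neg_mem s.2, by linear_combination -hs⟩

/-- If every element of `K` is a quotient of integer polynomials in the Misiurewicz point `c`, then
`a_n(c)` is a uniformizer at every prime above `d`. -/
lemma val_aSeq_eq_exp_neg_one {d m n : ℕ} (hd : d.Prime) (hm : 2 ≤ m) (hn : n ≠ 0)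
    (ha0 : aSeq d c n ≠ 0) (hvd : v (d : K) < 1) (hc : v c ≤ 1)
    (ha : ∀ k, v (aSeq d c k) < 1 ↔ n ∣ k) {t : K}
    (ht : aSeq d c (m - 1 + n) = t * aSeq d c (m - 1)) (ht1 : t ≠ 1) (htd : t ^ d = 1)
    (hK : ∀ x : K, ∃ F H : ℤ[X], aeval c H ≠ 0 ∧ x * aeval c H = aeval c F) {ϖ : K}
    (hϖ : v ϖ = exp (-1)) : v (aSeq d c n) = exp (-1) := by
  obtain ⟨s, hs, hts⟩ := sub_one_eq_aSeq_mul hd hm hn ha0 hc ha ht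
  have htS : t ∈ unitFractions v c := by
    rw [← sub_add_cancel t 1, hts]
    exact add_mem (mul_mem (aSeq_mem_unitFractions d n) hs) (one_mem _)
  obtain ⟨s', hs', hds'⟩ := exists_natCast_eq_sub_one_mul htS ht1 htd
  have han := (ha n).2 dvd_rfl
  have hϖ0 : ϖ ≠ 0 := by rintro rfl; rw [map_zero] at hϖ; exact exp_ne_zero hϖ.symm
  obtain ⟨j, hj⟩ := exists_val_eq_zpow hd hn hvd hc han ha0 (mul_mem hs hs')
    (by rw [hds', hts, mul_assoc]) hK hϖ0
  obtain ⟨l, hl⟩ := exists_exp_eq (v.ne_zero_iff.2 ha0)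
  rw [hl, ← exp_zero, exp_lt_exp] at han
  rw [hϖ, hl, ← exp_zsmul, exp_inj, smul_eq_mul] at hj
  rw [hl, exp_inj]
  rcases Int.isUnit_iff.1 (isUnit_of_dvd_unit (Dvd.intro_left j hj.symm) (by norm_num)) with h | h
  · omega
  · exact h

end CriticalValuation

lemma exists_aeval_eq_of_adjoin_simple {c₀ : ℂ} (x : ℚ⟮c₀⟯) :
    ∃ F H : ℤ[X], aeval (AdjoinSimple.gen ℚ c₀) H ≠ 0 ∧
      x * aeval (AdjoinSimple.gen ℚ c₀) H = aeval (AdjoinSimple.gen ℚ c₀) F := by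
  have hclear : ∀ r : ℚ[X], ∃ (b : ℤ) (P : ℤ[X]), b ≠ 0 ∧ ∀ y : ℚ⟮c₀⟯,
      aeval y P = b * aeval y r := by
    intro r
    obtain ⟨b, hb0, hb⟩ := IsLocalization.integerNormalization_spec (nonZeroDivisors ℤ) r
    refine ⟨b, IsLocalization.integerNormalization (nonZeroDivisors ℤ) r,
      nonZeroDivisors.ne_zero hb0, fun y => ?_⟩
    rw [← aeval_map_algebraMap ℚ, hb, zsmul_eq_mul, map_mul, map_intCast]
  obtain ⟨p, q, hpq⟩ := (mem_adjoin_simple_iff ℚ (x : ℂ)).1 x.2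
  have hgen : ∀ r : ℚ[X], ((aeval (AdjoinSimple.gen ℚ c₀) r : ℚ⟮c₀⟯) : ℂ) = aeval c₀ r := by
    intro r
    rw [← IntermediateField.coe_val, ← aeval_algHom_apply]
    rfl
  have hx : x = aeval (AdjoinSimple.gen ℚ c₀) p / aeval (AdjoinSimple.gen ℚ c₀) q := by
    apply Subtype.val_injective
    rw [hpq, IntermediateField.coe_div, hgen, hgen]
  by_cases hq : aeval (AdjoinSimple.gen ℚ c₀) q = 0
  · exact ⟨0, 1, by simp, by simp [hx, hq]⟩
  obtain ⟨b, P, hb, hP⟩ := hclear p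
  obtain ⟨b', Q, hb', hQ⟩ := hclear q
  refine ⟨C b' * P, C b * Q, ?_, ?_⟩
  · rw [map_mul, hQ, aeval_C]
    refine mul_ne_zero ?_ (mul_ne_zero ?_ hq) <;> simpa
  · rw [map_mul, map_mul, hQ, hP, aeval_C, aeval_C, hx]
    simp only [algebraMap_int_eq, eq_intCast]
    field_simp

/-- The critical orbit at a Misiurewicz point, in terms of the valuation at a prime above `d`. -/
lemma misiurewicz_valuation {d m n : ℕ} (hd : d.Prime) (hm : 2 ≤ m) (hn : n ≠ 0) {ζ c₀ : ℂ}
    (hζ1 : ζ ≠ 1) (hζd : ζ ^ d = 1) (hc₀ : isMisiurewiczRoot d m n ζ c₀)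
    (𝔭 : Ideal (integralClosure ℤ ℚ⟮c₀⟯)) [h𝔭 : 𝔭.IsPrime]
    (h𝔭d : (d : integralClosure ℤ ℚ⟮c₀⟯) ∈ 𝔭) :
    ∃ c : integralClosure ℤ ℚ⟮c₀⟯, (c : ℚ⟮c₀⟯) = AdjoinSimple.gen ℚ c₀ ∧
      (∀ k, aSeq d c k ∈ 𝔭 ↔ n ∣ k) ∧ aSeq d c n ≠ 0 ∧
      ∃ t : ℚ⟮c₀⟯, t ≠ 1 ∧ t ^ d = 1 ∧
        aSeq d (AdjoinSimple.gen ℚ c₀) (m - 1 + n) =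
          t * aSeq d (AdjoinSimple.gen ℚ c₀) (m - 1) := by
  obtain ⟨z, c', g, rfl, hc', hg, hgn, hgc⟩ :=
    exists_integral_of_isMisiurewiczRoot hd.two_le hm hζd hc₀
  let f : ℚ⟮c₀⟯ →ₐ[ℤ] ℂ := ℚ⟮c₀⟯.val.restrictScalars ℤ
  have hf : Function.Injective f := f.toRingHom.injective
  have hfg : f (AdjoinSimple.gen ℚ c₀) = c₀ := AdjoinSimple.coe_gen ℚ c₀
  let ι := f.mapIntegralClosure
  have hι : Function.Injective ι := fun x y hxy =>
    Subtype.ext (hf (congrArg (algebraMap (integralClosure ℤ ℂ) ℂ) hxy))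
  have hcint : IsIntegral ℤ (AdjoinSimple.gen ℚ c₀) := by
    rw [← isIntegral_algHom_iff f hf, hfg, ← hc']
    exact c'.2
  let c : integralClosure ℤ ℚ⟮c₀⟯ := ⟨AdjoinSimple.gen ℚ c₀, hcint⟩
  have hιc : ι c = c' := Subtype.ext (hfg.trans hc'.symm)
  have h_int : ι.toRingHom.IsIntegral := by
    refine RingHom.IsIntegral.tower_top (algebraMap ℤ _) ι.toRingHom ?_
    rw [ι.toRingHom_eq_coe, ι.comp_algebraMap]
    exact Algebra.IsIntegral.isIntegral (R := ℤ) (A := integralClosure ℤ ℂ)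
  let := ι.toRingHom.toAlgebra
  have : Algebra.IsIntegral (integralClosure ℤ ℚ⟮c₀⟯) (integralClosure ℤ ℂ) := ⟨h_int⟩
  obtain ⟨𝔔, -, h𝔔, h𝔔𝔭⟩ := Ideal.exists_ideal_over_prime_of_isIntegral 𝔭
    (⊥ : Ideal (integralClosure ℤ ℂ)) (by
      intro x hx
      rw [Ideal.mem_comap, Ideal.mem_bot] at hx
      rw [hι (hx.trans (map_zero ι).symm)]
      exact 𝔭.zero_mem)
  have hmem𝔔 : ∀ x, ι x ∈ 𝔔 ↔ x ∈ 𝔭 := fun x => by rw [← h𝔔𝔭]; rfl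
  have hd𝔔 : (d : integralClosure ℤ ℂ) ∈ 𝔔 := by
    rw [← map_natCast ι, hmem𝔔]; exact h𝔭d
  have hz : z ^ d = 1 := Subtype.ext hζd
  have hz1 : z ≠ 1 := fun h => hζ1 (congrArg Subtype.val h)
  have hmem := aSeq_mem_iff_dvd hd hm hn hd𝔔 hz hg hgn hgc
  obtain ⟨hrel, han⟩ := aSeq_relation_of_misiurewicz hd hm hn hd𝔔 hz hz1 hgn hgc hmem
  have hιa : ∀ k, ι (aSeq d c k) = aSeq d c' k := fun k => by
    rw [← hιc]; exact aSeq_map d ι.toRingHom c k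
  have hmem' : ∀ k, aSeq d c k ∈ 𝔭 ↔ n ∣ k := fun k => by rw [← hmem𝔔, hιa, hmem]
  have han' : aSeq d c n ≠ 0 := fun h => han (by rw [← hιa, h, map_zero])
  have hrel' : f (aSeq d (AdjoinSimple.gen ℚ c₀) (m - 1 + n)) =
      z * f (aSeq d (AdjoinSimple.gen ℚ c₀) (m - 1)) := by
    have := congrArg Subtype.val hrel
    rw [← hιa, ← hιa] at this
    rw [show AdjoinSimple.gen ℚ c₀ = algebraMap (integralClosure ℤ ℚ⟮c₀⟯) ℚ⟮c₀⟯ c from rfl,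
      ← aSeq_map, ← aSeq_map]
    exact this
  have hm0 : aSeq d (AdjoinSimple.gen ℚ c₀) (m - 1) ≠ 0 := by
    intro h0
    have h0' : aSeq d c (m - 1) = 0 := by
      apply Subtype.val_injective
      exact (aSeq_map d (algebraMap (integralClosure ℤ ℚ⟮c₀⟯) ℚ⟮c₀⟯) c (m - 1)).trans h0
    obtain ⟨j, hj⟩ := (hmem' (m - 1)).1 (h0' ▸ 𝔭.zero_mem)
    obtain ⟨j, rfl⟩ := Nat.exists_eq_succ_of_ne_zero (show j ≠ 0 by rintro rfl; omega)
    obtain ⟨r, hr⟩ := exists_aSeq_mul_eq hd.two_le c hn j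
    rw [← Nat.succ_eq_add_one, ← hj, h0'] at hr
    have h1 := (mul_eq_zero.1 hr.symm).resolve_left han'
    refine h𝔭.ne_top ((Ideal.eq_top_iff_one _).2 ?_)
    rw [← neg_eq_of_add_eq_zero_left h1]
    exact 𝔭.neg_mem (𝔭.mul_mem_right _ ((hmem' n).2 dvd_rfl))
  refine ⟨c, rfl, hmem', han', aSeq d (AdjoinSimple.gen ℚ c₀) (m - 1 + n) /
    aSeq d (AdjoinSimple.gen ℚ c₀) (m - 1), ?_, ?_, (div_mul_cancel₀ _ hm0).symm⟩
  all_goals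
    have hf0 : f (aSeq d (AdjoinSimple.gen ℚ c₀) (m - 1)) ≠ 0 := (map_ne_zero_iff f hf).2 hm0
    have hft : f (aSeq d (AdjoinSimple.gen ℚ c₀) (m - 1 + n) /
      aSeq d (AdjoinSimple.gen ℚ c₀) (m - 1)) = z := by
      rw [map_div₀, hrel', mul_div_cancel_right₀ _ hf0]
  · intro h
    rw [h, map_one] at hft
    exact hζ1 hft.symm
  · apply hf
    rw [map_pow, hft, map_one, hζd]

end Helpers

/-- Let `c₀` be a Misiurewicz parameter (root of `G_{d,m,n}^ζ`, with
`n ≥ 3` when `d = 2`), `K = ℚ(c₀)`, and `α ∈ K` with `v_𝔭(α) ≥ 2` at some prime `𝔭` of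
`O_K` above `d`. Then some iterated Galois group `Gal(f_{d,c₀}^N - α / K)` is non-abelian
(equivalently, the arboreal Galois group `G_∞(f_{d,c₀}, α)` is non-abelian). -/
theorem stmt8 (d : ℕ) (hd : Nat.Prime d) (ζ : ℂ) (hζ1 : ζ ≠ 1) (hζd : ζ ^ d = 1)
    (m n : ℕ) (hm : 2 ≤ m) (hn : 1 ≤ n) (hn2 : d = 2 → 3 ≤ n)
    (c₀ : ℂ) (hc₀ : isMisiurewiczRoot d m n ζ c₀)
    (α : ℚ⟮c₀⟯)
    (𝔭 : Ideal (integralClosure ℤ ℚ⟮c₀⟯)) (h𝔭 : 𝔭.IsPrime)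
    (h𝔭d : (d : integralClosure ℤ ℚ⟮c₀⟯) ∈ 𝔭)
    (hα : ∃ a b : integralClosure ℤ ℚ⟮c₀⟯, b ∉ 𝔭 ∧ α * b = a ∧ a ∈ 𝔭 ^ 2) :
    ∃ N : ℕ, 1 ≤ N ∧
      ∃ σ τ : (fIter d (IntermediateField.AdjoinSimple.gen ℚ c₀) N - C α).Gal,
        σ * τ ≠ τ * σ := by
  have hn0 : n ≠ 0 := by omega
  obtain ⟨c, hc, hmem, han, t, ht1, htd, ht⟩ :=
    misiurewicz_valuation hd hm hn0 hζ1 hζd hc₀ 𝔭 h𝔭d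
  have hcint : IsIntegral ℤ c₀ := by
    have := c.2.map (ℚ⟮c₀⟯.val.restrictScalars ℤ)
    rwa [hc] at this
  have : FiniteDimensional ℚ ℚ⟮c₀⟯ := adjoin.finiteDimensional hcint.tower_top
  have : IsDedekindDomain (integralClosure ℤ ℚ⟮c₀⟯) := integralClosure.isDedekindDomain ℤ ℚ ℚ⟮c₀⟯
  have : IsFractionRing (integralClosure ℤ ℚ⟮c₀⟯) ℚ⟮c₀⟯ :=
    integralClosure.isFractionRing_of_finite_extension ℚ ℚ⟮c₀⟯
  let P : IsDedekindDomain.HeightOneSpectrum (integralClosure ℤ ℚ⟮c₀⟯) :=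
    ⟨𝔭, h𝔭, fun h => hd.ne_zero (by
      rw [h, Ideal.mem_bot] at h𝔭d
      exact_mod_cast h𝔭d)⟩
  have hval : ∀ x : integralClosure ℤ ℚ⟮c₀⟯, P.valuation ℚ⟮c₀⟯ (x : ℚ⟮c₀⟯) < 1 ↔ x ∈ 𝔭 :=
    fun x => P.valuation_lt_one_iff_mem x
  have hval1 : ∀ x : integralClosure ℤ ℚ⟮c₀⟯, x ∉ 𝔭 → P.valuation ℚ⟮c₀⟯ (x : ℚ⟮c₀⟯) = 1 :=
    fun x hx => (P.valuation_eq_one_iff_notMem).2 hx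
  have haSeq : ∀ k, ((aSeq d c k : integralClosure ℤ ℚ⟮c₀⟯) : ℚ⟮c₀⟯) =
      aSeq d (AdjoinSimple.gen ℚ c₀) k := fun k => by
    rw [← hc]; exact aSeq_map d (algebraMap (integralClosure ℤ ℚ⟮c₀⟯) ℚ⟮c₀⟯) c k
  have ha : ∀ k, P.valuation ℚ⟮c₀⟯ (aSeq d (AdjoinSimple.gen ℚ c₀) k) < 1 ↔ n ∣ k := fun k => by
    rw [← haSeq, hval, hmem]
  have ha0 : aSeq d (AdjoinSimple.gen ℚ c₀) n ≠ 0 := by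
    rw [← haSeq]; exact fun h => han (Subtype.val_injective h)
  have hvd : P.valuation ℚ⟮c₀⟯ (d : ℚ⟮c₀⟯) < 1 := by
    have := (hval d).2 h𝔭d
    simpa using this
  have hvc : P.valuation ℚ⟮c₀⟯ (AdjoinSimple.gen ℚ c₀) ≤ 1 := by
    rw [← hc]; exact P.valuation_le_one c
  obtain ⟨ϖ, hϖ⟩ := P.valuation_exists_uniformizer ℚ⟮c₀⟯
  have han1 := val_aSeq_eq_exp_neg_one hd hm hn0 ha0 hvd hvc ha ht ht1 htd
    exists_aeval_eq_of_adjoin_simple hϖ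
  have hvα : P.valuation ℚ⟮c₀⟯ α ≤ WithZero.exp (-2) := by
    obtain ⟨a, b, hb, hab, ha2⟩ := hα
    have h1 : P.valuation ℚ⟮c₀⟯ (a : ℚ⟮c₀⟯) ≤ WithZero.exp (-2) := by
      rw [show (a : ℚ⟮c₀⟯) = algebraMap _ ℚ⟮c₀⟯ a from rfl, P.valuation_of_algebraMap]
      exact (P.intValuation_le_pow_iff_mem a 2).2 ha2
    rwa [← hab, map_mul, hval1 b hb, mul_one] at h1
  have htprim : IsPrimitiveRoot t d := by
    have : Fact d.Prime := ⟨hd⟩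
    rw [← orderOf_eq_prime htd ht1]
    exact IsPrimitiveRoot.orderOf t
  refine ⟨n + 1, by omega, exists_not_commute_of_valuation P hd hn0 htprim hvd hvc han1 hvα ?_ ?_⟩
  · intro h1
    have := hd.two_le
    by_contra hlt
    have := hn2 (by omega)
    omega
  · intro h1
    rw [← hc]
    refine hval1 c fun h => h1 (Nat.dvd_one.1 ((hmem 1).1 ?_))
    simpa [aSeq, hd.ne_zero] using h
end
end
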